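/- (Geometric forward-reverse Brascamp-Lieb inequality, first form.) Assume the scaling condition holds, and let linear maps Q_j: E_0 → E^j (1≤j≤m) and Σ ∈ Π(id_{E_1},…,id_{E_k}) satisfy Q_j Σ Q_j* = id_{E^j} for each 1≤j≤m and Σ_{j=1}^m d_j Q_j* Q_j ≤ Λ_c. If measurable functions f_i: E_i → [0,∞) (1≤i≤k) and g_j: E^j → [0,∞) (1≤j≤m) satisfy ∏_{i=1}^k f_i(π_{E_i}(x))^{c_i} ≤ ∏_{j=1}^m g_j(Q_j x)^{d_j} for all x ∈ E_0, then ∏_{i=1}^k (∫_{E_i} f_i)^{c_i} ≤ ∏_{j=1}^m (∫_{E^j} g_j)^{d_j}. -/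

import Mathlib

open MeasureTheory LinearMap
open scoped RealInnerProductSpace BigOperators NNReal ENNReal

noncomputable section

namespace FRBL

/-- A positive semidefinite (self-adjoint) operator on a real inner product space. -/
def PosSemidef {G : Type*} [NormedAddCommGroup G] [InnerProductSpace ℝ G]
    (A : G →ₗ[ℝ] G) : Prop :=
  A.IsSymmetric ∧ ∀ x : G, 0 ≤ ⟪A x, x⟫

/-- A positive definite (self-adjoint) operator on a real inner product space. -/
def PosDef {G : Type*} [NormedAddCommGroup G] [InnerProductSpace ℝ G]
    (A : G →ₗ[ℝ] G) : Prop :=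
  A.IsSymmetric ∧ ∀ x : G, x ≠ 0 → 0 < ⟪A x, x⟫

variable {k m : ℕ}
  (E : Fin k → Type*) (F : Fin m → Type*)
  [∀ i, NormedAddCommGroup (E i)] [∀ i, InnerProductSpace ℝ (E i)]
  [∀ i, FiniteDimensional ℝ (E i)]
  [∀ i, MeasurableSpace (E i)] [∀ i, BorelSpace (E i)]
  [∀ j, NormedAddCommGroup (F j)] [∀ j, InnerProductSpace ℝ (F j)]
  [∀ j, FiniteDimensional ℝ (F j)]
  [∀ j, MeasurableSpace (F j)] [∀ j, BorelSpace (F j)]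
  (c : Fin k → ℝ) (d : Fin m → ℝ)
  (B : ∀ i j, E i →ₗ[ℝ] F j)

/-- The pointwise domination hypothesis of the forward-reverse Brascamp-Lieb inequality. -/
def Hyp (f : ∀ i, E i → ℝ≥0) (g : ∀ j, F j → ℝ≥0) : Prop :=
  ∀ x : ∀ i, E i,
    (∏ i, f i (x i) ^ c i) ≤ ∏ j, g j (∑ i, c i • B i j (x i)) ^ d j

/-- `D₀` is an admissible constant for the forward-reverse Brascamp-Lieb inequality. -/
def IsBound (D₀ : ℝ) : Prop :=
  ∀ (f : ∀ i, E i → ℝ≥0) (g : ∀ j, F j → ℝ≥0),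
    (∀ i, Measurable (f i)) → (∀ j, Measurable (g j)) →
    Hyp E F c d B f g →
    (∏ i, (∫⁻ x, (f i x : ℝ≥0∞)) ^ c i) ≤
      ENNReal.ofReal (Real.exp D₀) * ∏ j, (∫⁻ y, (g j y : ℝ≥0∞)) ^ d j

/-- The best constant `D(c,d,B)` in the forward-reverse Brascamp-Lieb inequality. -/
def D : EReal :=
  sInf {x : EReal | ∃ D₀ : ℝ, x = (D₀ : EReal) ∧ IsBound E F c d B D₀}

/-- The gaussian constraint `Λ_c B* U_d B Λ_c ≤ V_c`, written via quadratic forms. -/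
def GaussCon (V : ∀ i, E i →ₗ[ℝ] E i) (U : ∀ j, F j →ₗ[ℝ] F j) : Prop :=
  ∀ x : ∀ i, E i,
    (∑ j, d j * ⟪U j (∑ i, c i • B i j (x i)), ∑ i, c i • B i j (x i)⟫) ≤
      ∑ i, c i * ⟪V i (x i), x i⟫

/-- The objective functional in the definition of the gaussian constant. -/
def gaussObj (V : ∀ i, E i →ₗ[ℝ] E i) (U : ∀ j, F j →ₗ[ℝ] F j) : ℝ :=
  (∑ j, d j * Real.log (LinearMap.det (U j)) -
    ∑ i, c i * Real.log (LinearMap.det (V i))) / 2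

/-- The gaussian best constant `D_g(c,d,B)`. -/
def Dg : EReal :=
  sSup {x : EReal | ∃ (V : ∀ i, E i →ₗ[ℝ] E i) (U : ∀ j, F j →ₗ[ℝ] F j),
    (∀ i, PosDef (V i)) ∧ (∀ j, PosDef (U j)) ∧ GaussCon E F c d B V U ∧
    x = (gaussObj E F c d V U : EReal)}

/-- The datum `(c,d,B)` is gaussian-extremizable: the supremum defining `D_g` is
finite and attained. -/
def GaussExt : Prop :=
  ∃ (V : ∀ i, E i →ₗ[ℝ] E i) (U : ∀ j, F j →ₗ[ℝ] F j),
    (∀ i, PosDef (V i)) ∧ (∀ j, PosDef (U j)) ∧ GaussCon E F c d B V U ∧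
    Dg E F c d B = (gaussObj E F c d V U : EReal)

/-- The canonical linear equivalence between `E₀ = ⊕ᵢ Eᵢ` (as `PiLp 2`) and the pi type. -/
def toPi : PiLp 2 E ≃ₗ[ℝ] ∀ i, E i := WithLp.linearEquiv 2 ℝ (∀ i, E i)

/-- Orthogonal projection `π_{E_i} : E₀ → E_i`. -/
def projL (i : Fin k) : PiLp 2 E →ₗ[ℝ] E i := (LinearMap.proj i).comp (toPi E).toLinearMap

/-- The embedding `E_i → E₀`. -/
def singleL (i : Fin k) : E i →ₗ[ℝ] PiLp 2 E :=
  (toPi E).symm.toLinearMap.comp (LinearMap.single ℝ E i)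

/-- The map `B_j : E₀ → E^j`, `x ↦ ∑ᵢ B_{ij} π_{E_i} x`. -/
def Bop (j : Fin m) : PiLp 2 E →ₗ[ℝ] F j := ∑ i, (B i j).comp (projL E i)

/-- `Λ_c = ⊕ᵢ cᵢ id_{E_i}` as an operator on `E₀`. -/
def Lam : PiLp 2 E →ₗ[ℝ] PiLp 2 E := ∑ i, c i • (singleL E i).comp (projL E i)

/-- The set `Π(A_1, …, A_k)` of positive semidefinite "couplings". -/
def Coupling (A : ∀ i, E i →ₗ[ℝ] E i) : Set (PiLp 2 E →ₗ[ℝ] PiLp 2 E) :=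
  {P | PosSemidef P ∧ ∀ (i : Fin k) (v : E i),
    ⟪P (singleL E i v), singleL E i v⟫ = ⟪A i v, v⟫}

/-- The scaling condition `∑ᵢ cᵢ dim Eᵢ = ∑ⱼ dⱼ dim E^j`. -/
def ScalingCond : Prop :=
  ∑ i, c i * (Module.finrank ℝ (E i) : ℝ) = ∑ j, d j * (Module.finrank ℝ (F j) : ℝ)

/-- A subspace `T ⊆ E₀` is of product form, i.e. `T = ⊕ᵢ π_{E_i} T`. -/
def ProductForm (T : Submodule ℝ (PiLp 2 E)) : Prop :=
  ∀ x ∈ T, ∀ i, singleL E i (projL E i x) ∈ T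

/-- The dimension condition over product-form subspaces. -/
def DimCond : Prop :=
  ∀ T : Submodule ℝ (PiLp 2 E), ProductForm E T →
    (∑ i, c i * (Module.finrank ℝ (T.map (projL E i)) : ℝ)) ≤
      ∑ j, d j * (Module.finrank ℝ (T.map (Bop E F B j)) : ℝ)

/-- A critical subspace. -/
def IsCritical (T : Submodule ℝ (PiLp 2 E)) : Prop :=
  T ≠ ⊥ ∧ T ≠ ⊤ ∧ ProductForm E T ∧
    ∑ i, c i * (Module.finrank ℝ (T.map (projL E i)) : ℝ) =
      ∑ j, d j * (Module.finrank ℝ (T.map (Bop E F B j)) : ℝ)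

/-- The datum is simple if it has no critical subspace. -/
def Simple : Prop := ∀ T : Submodule ℝ (PiLp 2 E), ¬ IsCritical E F c d B T

end FRBL

namespace FRBL

/-- `log det` with value `−∞` on operators with non-positive determinant
(in particular on singular positive-semidefinite operators). -/
def elogdet {G : Type*} [AddCommGroup G] [Module ℝ G] (A : G →ₗ[ℝ] G) : EReal :=
  if 0 < LinearMap.det A then ((Real.log (LinearMap.det A) : ℝ) : EReal) else ⊥

variable {k m : ℕ}
  (E : Fin k → Type*) (F : Fin m → Type*)
  [∀ i, NormedAddCommGroup (E i)] [∀ i, InnerProductSpace ℝ (E i)]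
  [∀ i, FiniteDimensional ℝ (E i)]
  [∀ j, NormedAddCommGroup (F j)] [∀ j, InnerProductSpace ℝ (F j)]
  [∀ j, FiniteDimensional ℝ (F j)]
  (c : Fin k → ℝ) (d : Fin m → ℝ)
  (B : ∀ i j, E i →ₗ[ℝ] F j)

/-- The map `Q_j := B_j Λ_c : E₀ → E^j`. -/
def BLam (j : Fin m) : PiLp 2 E →ₗ[ℝ] F j := (Bop E F B j).comp (Lam E c)

/-- The optimality condition of Theorem 2 (structure of gaussian extremizers):
each `B_j Λ_c Π Λ_c B_j*` is invertible and
`∑ⱼ dⱼ Λ_c B_j* (B_j Λ_c Π Λ_c B_j*)⁻¹ B_j Λ_c ≤ V_c` in the quadratic-form sense. -/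
def ExtCond (V : ∀ i, E i →ₗ[ℝ] E i) (P : PiLp 2 E →ₗ[ℝ] PiLp 2 E) : Prop :=
  (∀ j, IsUnit ((BLam E F c B j) ∘ₗ P ∘ₗ LinearMap.adjoint (BLam E F c B j))) ∧
  ∀ x : PiLp 2 E,
    (∑ j, d j * ⟪Ring.inverse ((BLam E F c B j) ∘ₗ P ∘ₗ LinearMap.adjoint (BLam E F c B j))
        (BLam E F c B j x), BLam E F c B j x⟫) ≤
      ∑ i, c i * ⟪V i (projL E i x), projL E i x⟫

/-- A geometric datum. -/
def Geometric : Prop :=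
  ScalingCond E F c d ∧
  ∃ S ∈ Coupling E (fun i => (LinearMap.id : E i →ₗ[ℝ] E i)),
    (∀ j, (BLam E F c B j) ∘ₗ S ∘ₗ LinearMap.adjoint (BLam E F c B j) = LinearMap.id) ∧
    ∀ x : PiLp 2 E, (∑ j, d j * ⟪BLam E F c B j x, BLam E F c B j x⟫) ≤ ⟪Lam E c x, x⟫

/-- Equivalence of data: `B'_j = C_j⁻¹ B_j C⁻¹` for invertible `C, C_j`. -/
def EquivData (B' : ∀ i j, E i →ₗ[ℝ] F j) : Prop :=
  ∃ (C : PiLp 2 E ≃ₗ[ℝ] PiLp 2 E) (Cj : ∀ j, F j ≃ₗ[ℝ] F j),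
    ∀ j, Bop E F B' j =
      ((Cj j).symm.toLinearMap ∘ₗ Bop E F B j) ∘ₗ C.symm.toLinearMap

/-- `V_c = ⊕ᵢ cᵢ Vᵢ` as an operator on `E₀`. -/
def blockDiag (V : ∀ i, E i →ₗ[ℝ] E i) : PiLp 2 E →ₗ[ℝ] PiLp 2 E :=
  ∑ i, c i • ((singleL E i) ∘ₗ (V i)) ∘ₗ (projL E i)

/-- `Θ = V_c − ∑ⱼ dⱼ Λ_c B_j* U_j B_j Λ_c`. -/
def Theta (V : ∀ i, E i →ₗ[ℝ] E i) (U : ∀ j, F j →ₗ[ℝ] F j) :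
    PiLp 2 E →ₗ[ℝ] PiLp 2 E :=
  blockDiag E c V -
    ∑ j, d j • (LinearMap.adjoint (BLam E F c B j) ∘ₗ (U j)) ∘ₗ (BLam E F c B j)

end FRBL

namespace FRBL

/-- Borel structure on submodules (inherited from the ambient space). -/
instance subBorel {G : Type*} [AddCommGroup G] [Module ℝ G] [TopologicalSpace G]
    [MeasurableSpace G] [BorelSpace G] (T : Submodule ℝ G) : BorelSpace ↥T :=
  Subtype.borelSpace (T : Set G)

/-- The maximal dimension of a subspace on which the self-adjoint operator `Q` is positive
definite; by Sylvester's law of inertia this is the number of positive eigenvalues of `Q`,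
counted with multiplicity. -/
def posIndex {H : Type*} [NormedAddCommGroup H] [InnerProductSpace ℝ H]
    (Q : H →ₗ[ℝ] H) : ℕ :=
  sSup {r : ℕ | ∃ W : Submodule ℝ H,
    (∀ x ∈ W, x ≠ 0 → 0 < ⟪Q x, x⟫) ∧ Module.finrank ℝ W = r}

/-- The standard gaussian probability measure on a Euclidean space. -/
def stdGaussian (G : Type*) [NormedAddCommGroup G] [InnerProductSpace ℝ G]
    [FiniteDimensional ℝ G] [MeasurableSpace G] [BorelSpace G] :
    Measure G :=
  volume.withDensity fun x =>
    ENNReal.ofReal ((2 * Real.pi) ^ (-(Module.finrank ℝ G : ℝ) / 2) *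
      Real.exp (-‖x‖ ^ 2 / 2))

/-- `K_s = (|s|^{1/s} |s'|^{1/s'})^{1/2}`. -/
def Kconst (s s' : ℝ) : ℝ := Real.sqrt (|s| ^ (1 / s) * |s'| ^ (1 / s'))

variable {k m : ℕ}
  (E : Fin k → Type*) (F : Fin m → Type*)
  [∀ i, NormedAddCommGroup (E i)] [∀ i, InnerProductSpace ℝ (E i)]
  [∀ i, FiniteDimensional ℝ (E i)]
  [∀ j, NormedAddCommGroup (F j)] [∀ j, InnerProductSpace ℝ (F j)]
  [∀ j, FiniteDimensional ℝ (F j)]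
  (c : Fin k → ℝ) (d : Fin m → ℝ)
  (B : ∀ i j, E i →ₗ[ℝ] F j)

/-- The objective functional `∑ⱼ dⱼ log det Uⱼ − ∑ᵢ cᵢ log det Vᵢ`. -/
def objective (V : ∀ i, E i →ₗ[ℝ] E i) (U : ∀ j, F j →ₗ[ℝ] F j) : ℝ :=
  ∑ j, d j * Real.log (LinearMap.det (U j)) - ∑ i, c i * Real.log (LinearMap.det (V i))

/-- Feasibility for the optimization problem defining `D_g`: positive definiteness
together with the constraint `Θ ≥ 0`. -/
def Admissible (V : ∀ i, E i →ₗ[ℝ] E i) (U : ∀ j, F j →ₗ[ℝ] F j) : Prop :=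
  (∀ i, PosDef (V i)) ∧ (∀ j, PosDef (U j)) ∧ PosSemidef (Theta E F c d B V U)

/-- Global maximality in the optimization problem defining `D_g`. -/
def IsGlobalMax (V : ∀ i, E i →ₗ[ℝ] E i) (U : ∀ j, F j →ₗ[ℝ] F j) : Prop :=
  Admissible E F c d B V U ∧
    ∀ V' U', Admissible E F c d B V' U' →
      objective E F c d V' U' ≤ objective E F c d V U

/-- Local maximality in the optimization problem defining `D_g`. -/
def IsLocalMax (V : ∀ i, E i →ₗ[ℝ] E i) (U : ∀ j, F j →ₗ[ℝ] F j) : Prop :=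
  Admissible E F c d B V U ∧
    ∃ ε : ℝ, 0 < ε ∧
      ∀ V' U', Admissible E F c d B V' U' →
        (∀ i, ‖LinearMap.toContinuousLinearMap (V' i - V i)‖ < ε) →
        (∀ j, ‖LinearMap.toContinuousLinearMap (U' j - U j)‖ < ε) →
        objective E F c d V' U' ≤ objective E F c d V U

end FRBL

namespace FRBL

set_option linter.unusedSectionVars false

section Gaussian

variable {V : Type*} [NormedAddCommGroup V] [InnerProductSpace ℝ V]

/-- The density of the standard gaussian measure. -/
def gaussDensity (V : Type*) [NormedAddCommGroup V] [InnerProductSpace ℝ V] (x : V) : ℝ :=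
  (2 * Real.pi) ^ (-(Module.finrank ℝ V : ℝ) / 2) * Real.exp (-‖x‖ ^ 2 / 2)

lemma gaussDensity_pos (x : V) : 0 < gaussDensity V x := by
  unfold gaussDensity; positivity

lemma measurable_gaussDensity [MeasurableSpace V] [BorelSpace V] : Measurable (gaussDensity V) := by
  unfold gaussDensity; fun_prop

variable [FiniteDimensional ℝ V] [MeasurableSpace V] [BorelSpace V]

lemma integral_stdGaussian {H : Type*} [NormedAddCommGroup H] [NormedSpace ℝ H] (φ : V → H) :
    ∫ x, φ x ∂stdGaussian V = ∫ x, gaussDensity V x • φ x := by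
  unfold stdGaussian
  rw [integral_withDensity_eq_integral_toReal_smul]
  · refine integral_congr_ae (.of_forall fun x => ?_)
    simp only [gaussDensity]
    rw [ENNReal.toReal_ofReal (by positivity)]
  · exact measurable_gaussDensity.ennreal_ofReal
  · exact .of_forall fun x => ENNReal.ofReal_lt_top

lemma lintegral_stdGaussian (φ : V → ℝ≥0∞) :
    ∫⁻ x, φ x ∂stdGaussian V = ∫⁻ x, ENNReal.ofReal (gaussDensity V x) * φ x :=
  lintegral_withDensity_eq_lintegral_mul_non_measurable _ measurable_gaussDensity.ennreal_ofReal
    (.of_forall fun _ => ENNReal.ofReal_lt_top) φ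

lemma integrable_stdGaussian_iff {φ : V → ℝ} :
    Integrable φ (stdGaussian V) ↔ Integrable (fun x => gaussDensity V x * φ x) volume := by
  change Integrable φ (volume.withDensity fun x => ENNReal.ofReal (gaussDensity V x)) ↔ _
  rw [integrable_withDensity_iff_integrable_smul' (measurable_gaussDensity.ennreal_ofReal)
    (.of_forall fun x => ENNReal.ofReal_lt_top)]
  refine integrable_congr (.of_forall fun x => ?_)
  simp only [smul_eq_mul]
  rw [ENNReal.toReal_ofReal (gaussDensity_pos x).le]

lemma integrable_exp_neg_mul_sq_norm {b : ℝ} (hb : 0 < b) :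
    Integrable (fun x : V => Real.exp (-b * ‖x‖ ^ 2)) := by
  have h := (GaussianFourier.integrable_cexp_neg_mul_sq_norm_add (V := V) (b := (b : ℂ))
    (by simpa using hb) 0 0).norm
  refine h.congr (.of_forall fun x => ?_)
  simp only [Complex.norm_exp]
  congr 1
  norm_cast
  simp

lemma integral_gaussDensity : ∫ x : V, gaussDensity V x = 1 := by
  have h := GaussianFourier.integral_rexp_neg_mul_sq_norm (V := V) (b := 1 / 2) (by norm_num)
  simp only [gaussDensity]
  rw [integral_const_mul]
  have e : ∀ x : V, Real.exp (-‖x‖ ^ 2 / 2) = Real.exp (-(1 / 2) * ‖x‖ ^ 2) := fun x => by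
    congr 1; ring
  simp only [e]
  rw [h, show Real.pi / (1 / 2) = 2 * Real.pi by ring, ← Real.rpow_add (by positivity)]
  rw [show -(Module.finrank ℝ V : ℝ) / 2 + (Module.finrank ℝ V : ℝ) / 2 = 0 by ring, Real.rpow_zero]

instance isProbabilityMeasure_stdGaussian : IsProbabilityMeasure (stdGaussian V) := by
  constructor
  have hi : Integrable (gaussDensity V) volume := by
    by_contra hcon
    have := integral_gaussDensity (V := V)
    rw [integral_undef hcon] at this
    exact zero_ne_one this
  have := ofReal_integral_eq_lintegral_ofReal hi (.of_forall fun x => (gaussDensity_pos x).le)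
  rw [← lintegral_one, lintegral_stdGaussian]
  simp only [mul_one]
  rw [← this, integral_gaussDensity, ENNReal.ofReal_one]

lemma charFun_stdGaussian (t : V) :
    charFun (stdGaussian V) t = Complex.exp (-(‖t‖ ^ 2 / 2 : ℝ)) := by
  rw [charFun_apply, integral_stdGaussian]
  have h := GaussianFourier.integral_cexp_neg_mul_sq_norm_add (V := V) (b := 1 / 2)
    (by norm_num) Complex.I t
  have e : ∀ x : V, gaussDensity V x • Complex.exp (⟪x, t⟫ * Complex.I) =
      ((2 * Real.pi) ^ (-(Module.finrank ℝ V : ℝ) / 2) : ℝ) *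
        Complex.exp (-(1 / 2) * ‖x‖ ^ 2 + Complex.I * ⟪t, x⟫) := fun x => by
    rw [gaussDensity, Complex.real_smul, Complex.exp_add, real_inner_comm]
    push_cast
    rw [mul_assoc]
    congr 2
    · congr 1; ring
    · rw [mul_comm]
  simp only [e]
  rw [integral_const_mul, h, ← mul_assoc]
  have h1 : (((2 * Real.pi) ^ (-(Module.finrank ℝ V : ℝ) / 2) : ℝ) : ℂ) *
      (Real.pi / (1 / 2 : ℂ)) ^ (Module.finrank ℝ V / 2 : ℂ) = 1 := by
    rw [show (Real.pi / (1 / 2 : ℂ)) = ((2 * Real.pi : ℝ) : ℂ) by push_cast; ring,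
      show (Module.finrank ℝ V / 2 : ℂ) = ((Module.finrank ℝ V / 2 : ℝ) : ℂ) by push_cast; ring,
      ← Complex.ofReal_cpow (by positivity), ← Complex.ofReal_mul, ← Real.rpow_add (by positivity),
      show -(Module.finrank ℝ V : ℝ) / 2 + (Module.finrank ℝ V : ℝ) / 2 = 0 by ring, Real.rpow_zero]
    simp
  rw [h1, one_mul]
  congr 1
  push_cast
  rw [Complex.I_sq]
  ring

/-- The image of a standard gaussian measure under a coisometry is standard gaussian. -/
lemma map_stdGaussian_of_comp_adjoint {W : Type*} [NormedAddCommGroup W] [InnerProductSpace ℝ W]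
    [FiniteDimensional ℝ W] [MeasurableSpace W] [BorelSpace W] (A : W →ₗ[ℝ] V)
    (hA : ∀ t, ‖LinearMap.adjoint A t‖ = ‖t‖) :
    (stdGaussian W).map A = stdGaussian V := by
  have hm : Measurable A := A.continuous_of_finiteDimensional.measurable
  have := Measure.isProbabilityMeasure_map (μ := stdGaussian W) hm.aemeasurable
  refine Measure.ext_of_charFun (funext fun t => ?_)
  rw [charFun_stdGaussian, ← hA t, ← charFun_stdGaussian, charFun_apply, charFun_apply,
    integral_map hm.aemeasurable (by fun_prop)]
  simp only [LinearMap.adjoint_inner_right]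

/-- The centered gaussian measure with covariance `s • id`. -/
def gaussScaled (V : Type*) [NormedAddCommGroup V] [InnerProductSpace ℝ V]
    [FiniteDimensional ℝ V] [MeasurableSpace V] [BorelSpace V] (s : ℝ) : Measure V :=
  (stdGaussian V).map fun z => Real.sqrt s • z

instance isProbabilityMeasure_gaussScaled (s : ℝ) : IsProbabilityMeasure (gaussScaled V s) :=
  Measure.isProbabilityMeasure_map (by fun_prop)

lemma charFun_gaussScaled {s : ℝ} (hs : 0 ≤ s) (t : V) :
    charFun (gaussScaled V s) t = Complex.exp (-(s * ‖t‖ ^ 2 / 2 : ℝ)) := by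
  rw [gaussScaled, charFun_map_smul, charFun_stdGaussian, norm_smul, mul_pow, Real.norm_eq_abs,
    sq_abs, Real.sq_sqrt hs]

lemma gaussScaled_conv {s t : ℝ} (hs : 0 ≤ s) (ht : 0 ≤ t) :
    (gaussScaled V s).conv (gaussScaled V t) = gaussScaled V (s + t) := by
  refine Measure.ext_of_charFun (funext fun v => ?_)
  rw [charFun_conv, charFun_gaussScaled hs, charFun_gaussScaled ht,
    charFun_gaussScaled (add_nonneg hs ht), ← Complex.exp_add]
  congr 1
  push_cast
  ring

lemma gaussScaled_one : gaussScaled V 1 = stdGaussian V := by simp [gaussScaled]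

lemma gaussScaled_zero : gaussScaled V 0 = Measure.dirac 0 := by
  simp [gaussScaled, Measure.map_const]

lemma integral_stdGaussian_shift (φ : V → ℝ) (a : V) :
    ∫ z, φ z ∂stdGaussian V =
      ∫ z, Real.exp (-⟪a, z⟫ - ‖a‖ ^ 2 / 2) * φ (z + a) ∂stdGaussian V := by
  rw [integral_stdGaussian, integral_stdGaussian, ← integral_add_right_eq_self _ a]
  refine integral_congr_ae (.of_forall fun z => ?_)
  simp only [smul_eq_mul, gaussDensity]
  rw [← mul_assoc]
  congr 1
  rw [mul_assoc, ← Real.exp_add, norm_add_sq_real, real_inner_comm]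
  congr 2
  ring

lemma integrable_exp_norm_stdGaussian (a b : ℝ) :
    Integrable (fun z : V => Real.exp (a + b * ‖z‖)) (stdGaussian V) := by
  rw [integrable_stdGaussian_iff]
  refine ((integrable_exp_neg_mul_sq_norm (V := V) (b := 1 / 4) (by norm_num)).const_mul
    ((2 * Real.pi) ^ (-(Module.finrank ℝ V : ℝ) / 2) * Real.exp (a + b ^ 2))).mono'
    ((measurable_gaussDensity.mul (by fun_prop)).aestronglyMeasurable) (.of_forall fun z => ?_)
  rw [Real.norm_of_nonneg (by have := gaussDensity_pos z; positivity), gaussDensity, mul_assoc,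
    mul_assoc, ← Real.exp_add, ← Real.exp_add]
  refine mul_le_mul_of_nonneg_left (Real.exp_le_exp.2 ?_) (by positivity)
  nlinarith [sq_nonneg (b - ‖z‖ / 2)]

lemma integrable_norm_stdGaussian : Integrable (fun z : V => ‖z‖) (stdGaussian V) := by
  refine (integrable_exp_norm_stdGaussian 0 1).mono' (by fun_prop) (.of_forall fun z => ?_)
  rw [norm_norm]
  linarith [Real.add_one_le_exp (0 + 1 * ‖z‖)]

lemma integrable_inner_stdGaussian (v : V) : Integrable (fun z : V => ⟪v, z⟫) (stdGaussian V) := by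
  refine (integrable_norm_stdGaussian.const_mul ‖v‖).mono' (by fun_prop) (.of_forall fun z => ?_)
  exact abs_real_inner_le_norm v z

lemma integral_inner_stdGaussian (v : V) : ∫ z, ⟪v, z⟫ ∂stdGaussian V = 0 := by
  rw [integral_stdGaussian]
  have h := integral_neg_eq_self (fun z : V => gaussDensity V z • ⟪v, z⟫) volume
  have e : ∀ z : V, gaussDensity V (-z) • ⟪v, -z⟫ = -(gaussDensity V z • ⟪v, z⟫) := fun z => by
    simp [gaussDensity]
  simp only [e, integral_neg] at h
  linarith

end Gaussian

section OneStep

variable {V : Type*} [NormedAddCommGroup V] [InnerProductSpace ℝ V]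
  [FiniteDimensional ℝ V] [MeasurableSpace V] [BorelSpace V]

lemma integrable_of_abs_le {Ω : Type*} [MeasurableSpace Ω] {μ : Measure Ω} [IsFiniteMeasure μ]
    {f : Ω → ℝ} (hf : Measurable f) {B : ℝ} (hB : ∀ x, |f x| ≤ B) : Integrable f μ :=
  .of_bound hf.aestronglyMeasurable B (.of_forall hB)

/-- Jensen's inequality for the exponential. -/
lemma integral_le_log_integral_exp {Ω : Type*} [MeasurableSpace Ω] {μ : Measure Ω}
    [IsProbabilityMeasure μ] {f : Ω → ℝ} (hf : Integrable f μ)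
    (he : Integrable (fun x => Real.exp (f x)) μ) :
    ∫ x, f x ∂μ ≤ Real.log (∫ x, Real.exp (f x) ∂μ) := by
  have h := convexOn_exp.map_integral_le Real.continuous_exp.continuousOn isClosed_univ
    (.of_forall fun _ => Set.mem_univ _) hf he
  exact (Real.le_log_iff_exp_le (integral_exp_pos he)).2 h

lemma integral_exp_stdGaussian_shift (F : V → ℝ) (x u : V) {h : ℝ} (hh : 0 ≤ h) :
    ∫ z, Real.exp (F (x + √h • z)) ∂stdGaussian V =
      ∫ z, Real.exp (F (x + h • u + √h • z) - √h * ⟪u, z⟫ - h * ‖u‖ ^ 2 / 2)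
        ∂stdGaussian V := by
  rw [integral_stdGaussian_shift _ (√h • u)]
  refine integral_congr_ae (.of_forall fun z => ?_)
  simp only
  rw [← Real.exp_add, smul_add, smul_smul, Real.mul_self_sqrt hh, real_inner_smul_left, norm_smul,
    mul_pow, Real.norm_eq_abs, sq_abs, Real.sq_sqrt hh,
    show x + (√h • z + h • u) = x + h • u + √h • z by abel]
  congr 1
  ring

lemma integral_sub_le_log_integral_exp {G : V → ℝ} (hG : Measurable G) {B : ℝ}
    (hB : ∀ x, |G x| ≤ B) (y v : V) {h : ℝ} (hh : 0 ≤ h) :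
    ∫ z, G (y + h • v + √h • z) ∂stdGaussian V - h * ‖v‖ ^ 2 / 2 ≤
      Real.log (∫ z, Real.exp (G (y + √h • z)) ∂stdGaussian V) := by
  rw [integral_exp_stdGaussian_shift G y v hh]
  have hi1 : Integrable (fun z => G (y + h • v + √h • z)) (stdGaussian V) :=
    integrable_of_abs_le (by fun_prop) fun z => hB _
  have hi2 : Integrable (fun z => √h * ⟪v, z⟫) (stdGaussian V) :=
    (integrable_inner_stdGaussian v).const_mul _
  have hi3 : Integrable (fun z => G (y + h • v + √h • z) - √h * ⟪v, z⟫ - h * ‖v‖ ^ 2 / 2)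
    (stdGaussian V) := (hi1.sub hi2).sub (integrable_const _)
  refine le_trans (le_of_eq ?_) (integral_le_log_integral_exp hi3 ?_)
  · have hi4 : Integrable (fun z => G (y + h • v + √h • z) - √h * ⟪v, z⟫) (stdGaussian V) :=
      hi1.sub hi2
    rw [integral_sub hi4 (integrable_const _), integral_sub hi1 hi2,
      integral_const_mul, integral_inner_stdGaussian]
    simp
  · refine (integrable_exp_norm_stdGaussian B (√h * ‖v‖)).mono'
      (by fun_prop) (.of_forall fun z => ?_)
    rw [Real.norm_of_nonneg (Real.exp_pos _).le]
    refine Real.exp_le_exp.2 ?_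
    have h1 := (le_abs_self _).trans (hB (y + h • v + √h • z))
    have h2 := mul_le_mul_of_nonneg_left (abs_real_inner_le_norm v z) (Real.sqrt_nonneg h)
    have h3 := mul_le_mul_of_nonneg_left (neg_abs_le ⟪v, z⟫) (Real.sqrt_nonneg h)
    nlinarith [mul_nonneg hh (sq_nonneg ‖v‖)]

lemma exp_le_one_add_add_sq_mul_exp_abs (r : ℝ) :
    Real.exp r ≤ 1 + r + r ^ 2 * Real.exp |r| := by
  have h := Complex.norm_exp_sub_sum_le_norm_mul_exp (r : ℂ) 2
  simp only [Finset.sum_range_succ, Finset.sum_range_zero, pow_zero, Nat.factorial, pow_one] at h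
  norm_num at h
  rw [← Complex.ofReal_exp, ← Complex.ofReal_one, ← Complex.ofReal_add, ← Complex.ofReal_sub,
    Complex.norm_real, Real.norm_eq_abs] at h
  linarith [le_abs_self (Real.exp r - (1 + r))]

/-- The constant in the second-order expansion of the exponential integral. -/
def stepConst (V : Type*) [NormedAddCommGroup V] [InnerProductSpace ℝ V]
    [FiniteDimensional ℝ V] [MeasurableSpace V] [BorelSpace V] (B L A : ℝ) : ℝ :=
  24 * A ^ 2 * ∫ z, Real.exp (2 * B + (L + 1) * L + (L + 1) * ‖z‖) ∂stdGaussian V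

lemma log_integral_exp_le {F : V → ℝ} (hF : Measurable F) {B L A : ℝ} (hB : ∀ x, |F x| ≤ B)
    (x u : V) (hu : ‖u‖ ≤ L) (hA : ∀ z, |F (x + z) - F x - ⟪u, z⟫| ≤ A * ‖z‖ ^ 2)
    {h : ℝ} (hh : 0 ≤ h) (h1 : h ≤ 1) :
    Real.log (∫ z, Real.exp (F (x + √h • z)) ∂stdGaussian V) ≤
      ∫ z, F (x + h • u + √h • z) ∂stdGaussian V - h * ‖u‖ ^ 2 / 2 + stepConst V B L A * h ^ 2 := by
  have hL : 0 ≤ L := (norm_nonneg u).trans hu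
  set p : V → V := fun z => h • u + √h • z with hp
  set r : V → ℝ := fun z => F (x + p z) - F x - ⟪u, p z⟫ with hr
  have hpn : ∀ z, ‖p z‖ ≤ √h * (L + ‖z‖) := fun z => by
    have hs : h ≤ √h := by
      rw [Real.le_sqrt hh hh]; nlinarith
    calc ‖p z‖ ≤ ‖h • u‖ + ‖√h • z‖ := norm_add_le _ _
      _ = h * ‖u‖ + √h * ‖z‖ := by
          rw [norm_smul, norm_smul, Real.norm_of_nonneg hh,
            Real.norm_of_nonneg (Real.sqrt_nonneg h)]
      _ ≤ √h * L + √h * ‖z‖ := by gcongr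
      _ = _ := by ring
  have hs1 : √h ≤ 1 := Real.sqrt_le_one.2 h1
  have hpn' : ∀ z, ‖p z‖ ≤ L + ‖z‖ := fun z => (hpn z).trans
    (mul_le_of_le_one_left (by positivity) hs1)
  have hrm : Measurable r := by fun_prop
  have hr1 : ∀ z, |r z| ≤ 2 * B + L * (L + ‖z‖) := fun z => by
    have e1 := hB (x + p z)
    have e2 := hB x
    have e3 := (abs_real_inner_le_norm u (p z)).trans
      (mul_le_mul hu (hpn' z) (norm_nonneg _) hL)
    simp only [hr]
    rw [abs_le] at *
    constructor <;> linarith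
  have hr2 : ∀ z, r z ^ 2 * Real.exp |r z| ≤
      24 * A ^ 2 * Real.exp (2 * B + (L + 1) * L + (L + 1) * ‖z‖) * h ^ 2 := fun z => by
    have e1 : |r z| ≤ |A| * (h * (L + ‖z‖) ^ 2) := by
      refine (hA (p z)).trans ?_
      refine mul_le_mul (le_abs_self A) ?_ (by positivity) (abs_nonneg A)
      calc ‖p z‖ ^ 2 ≤ (√h * (L + ‖z‖)) ^ 2 := by gcongr; exact hpn z
        _ = _ := by rw [mul_pow, Real.sq_sqrt hh]
    have e2 : r z ^ 2 ≤ A ^ 2 * h ^ 2 * (L + ‖z‖) ^ 4 := by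
      rw [← sq_abs (r z)]
      calc |r z| ^ 2 ≤ (|A| * (h * (L + ‖z‖) ^ 2)) ^ 2 := by gcongr
        _ = |A| ^ 2 * h ^ 2 * (L + ‖z‖) ^ 4 := by ring
        _ = _ := by rw [sq_abs]
    have e3 : (L + ‖z‖) ^ 4 ≤ 24 * Real.exp (L + ‖z‖) := by
      have := Real.pow_div_factorial_le_exp (L + ‖z‖) (by positivity) 4
      rw [show ((4 : ℕ).factorial : ℝ) = 24 by norm_num [Nat.factorial]] at this
      linarith
    calc r z ^ 2 * Real.exp |r z|
        ≤ (A ^ 2 * h ^ 2 * (24 * Real.exp (L + ‖z‖))) * Real.exp (2 * B + L * (L + ‖z‖)) := by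
          refine mul_le_mul (e2.trans ?_) (Real.exp_le_exp.2 (hr1 z)) (Real.exp_pos _).le
            (by positivity)
          gcongr
      _ = 24 * A ^ 2 * (Real.exp (L + ‖z‖) * Real.exp (2 * B + L * (L + ‖z‖))) * h ^ 2 := by ring
      _ = _ := by rw [← Real.exp_add]; ring_nf
  have hEint := integrable_exp_norm_stdGaussian (V := V) (2 * B + (L + 1) * L) (L + 1)
  have hEint' := integrable_exp_norm_stdGaussian (V := V) (2 * B + L * L) L
  have hri : Integrable r (stdGaussian V) := by
    refine hEint'.mono' hrm.aestronglyMeasurable (.of_forall fun z => ?_)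
    rw [Real.norm_eq_abs]
    linarith [hr1 z, Real.add_one_le_exp (2 * B + L * L + L * ‖z‖)]
  have hei : Integrable (fun z => Real.exp (r z)) (stdGaussian V) := by
    refine hEint'.mono' (by fun_prop) (.of_forall fun z => ?_)
    rw [Real.norm_of_nonneg (Real.exp_pos _).le]
    refine Real.exp_le_exp.2 ?_
    linarith [hr1 z, le_abs_self (r z)]
  have key : ∫ z, Real.exp (r z) ∂stdGaussian V ≤
      1 + ∫ z, r z ∂stdGaussian V + stepConst V B L A * h ^ 2 := by
    have hi := (((integrable_const (1 : ℝ)).add hri).add ((hEint.const_mul (24 * A ^ 2)).mul_const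
      (h ^ 2)))
    refine (integral_mono hei hi fun z => ?_).trans (le_of_eq ?_)
    · exact (exp_le_one_add_add_sq_mul_exp_abs (r z)).trans (by simpa using hr2 z)
    · rw [integral_add' ((integrable_const (1 : ℝ)).add hri)
        ((hEint.const_mul (24 * A ^ 2)).mul_const (h ^ 2)), integral_add' (integrable_const _) hri,
        integral_mul_const, integral_const_mul]
      simp [stepConst]
  have hshift : ∫ z, Real.exp (F (x + √h • z)) ∂stdGaussian V =
      Real.exp (F x + h * ‖u‖ ^ 2 / 2) * ∫ z, Real.exp (r z) ∂stdGaussian V := by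
    rw [integral_exp_stdGaussian_shift F x u hh, ← integral_const_mul]
    refine integral_congr_ae (.of_forall fun z => ?_)
    simp only [hr, hp]
    rw [← Real.exp_add, inner_add_right, real_inner_smul_right, real_inner_smul_right,
      real_inner_self_eq_norm_sq, ← add_assoc]
    congr 1
    ring
  have hpos : 0 < ∫ z, Real.exp (r z) ∂stdGaussian V := integral_exp_pos hei
  rw [hshift, Real.log_mul (Real.exp_pos _).ne' hpos.ne', Real.log_exp]
  have hlog := Real.log_le_sub_one_of_pos hpos
  have hFi : Integrable (fun z => F (x + h • u + √h • z)) (stdGaussian V) :=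
    integrable_of_abs_le (by fun_prop) fun z => hB _
  have hI : ∫ z, r z ∂stdGaussian V =
      ∫ z, F (x + h • u + √h • z) ∂stdGaussian V - F x - h * ‖u‖ ^ 2 := by
    have e : ∀ z, r z = F (x + h • u + √h • z) - (F x + h * ‖u‖ ^ 2) - √h * ⟪u, z⟫ := fun z => by
      simp only [hr, hp]
      rw [inner_add_right, real_inner_smul_right, real_inner_smul_right,
        real_inner_self_eq_norm_sq, ← add_assoc]
      ring
    simp only [e]
    have hFc : Integrable (fun z => F (x + h • u + √h • z) - (F x + h * ‖u‖ ^ 2))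
      (stdGaussian V) := hFi.sub (integrable_const _)
    rw [integral_sub hFc ((integrable_inner_stdGaussian u).const_mul _),
      integral_sub hFi (integrable_const _), integral_const_mul, integral_inner_stdGaussian]
    simp
    ring
  linarith

end OneStep

section Regular

variable {V : Type*} [NormedAddCommGroup V] [InnerProductSpace ℝ V]
  [FiniteDimensional ℝ V] [MeasurableSpace V] [BorelSpace V]

/-- Functions pinched between two positive constants, Lipschitz, with uniform first order Taylor
expansion. -/
structure IsRegular (f : V → ℝ) (ε M L A : ℝ) : Prop where
  measurable : Measurable f
  pos : 0 < ε
  lower : ∀ x, ε ≤ f x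
  upper : ∀ x, f x ≤ M
  lip : ∀ x z, |f (x + z) - f x| ≤ L * ‖z‖
  taylor : ∃ w : V → V, Measurable w ∧ (∀ x, ‖w x‖ ≤ L) ∧
    ∀ x z, |f (x + z) - f x - ⟪w x, z⟫| ≤ A * ‖z‖ ^ 2

/-- Average of the translates of `f` with respect to `μ`. -/
def average (μ : Measure V) (f : V → ℝ) (x : V) : ℝ := ∫ z, f (x + z) ∂μ

lemma measurable_average (μ : Measure V) [SFinite μ] {f : V → ℝ} (hf : Measurable f) :
    Measurable (average μ f) := by
  have : StronglyMeasurable (Function.uncurry fun x z : V => f (x + z)) :=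
    (hf.comp measurable_add).stronglyMeasurable
  exact this.integral_prod_right.measurable

lemma average_average (μ ν : Measure V) [IsProbabilityMeasure μ] [IsProbabilityMeasure ν]
    {f : V → ℝ} (hf : Measurable f) {C : ℝ} (hC : ∀ x, |f x| ≤ C) (x : V) :
    average ν (average μ f) x = average (μ.conv ν) f x := by
  have hm : Measurable fun z => f (x + z) := hf.comp (measurable_const_add x)
  unfold average Measure.conv
  rw [integral_map measurable_add.aemeasurable hm.aestronglyMeasurable, integral_prod_symm]
  · refine integral_congr_ae (.of_forall fun z => integral_congr_ae (.of_forall fun y => ?_))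
    simp only
    congr 1
    abel
  · exact integrable_of_abs_le (hm.comp measurable_add) (B := C) fun p => hC _

lemma average_mem_Icc (μ : Measure V) [IsProbabilityMeasure μ] {f : V → ℝ} (hf : Measurable f)
    {a b : ℝ} (ha : ∀ x, a ≤ f x) (hb : ∀ x, f x ≤ b) (x : V) :
    a ≤ average μ f x ∧ average μ f x ≤ b := by
  have hi : Integrable (fun z => f (x + z)) μ :=
    integrable_of_abs_le (hf.comp (measurable_const_add x)) (B := max |a| |b|) fun z =>
      abs_le_max_abs_abs (ha _) (hb _)
  constructor
  · simpa [average] using integral_mono (integrable_const a) hi fun z => ha (x + z)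
  · simpa [average] using integral_mono hi (integrable_const b) fun z => hb (x + z)

lemma IsRegular.average {f : V → ℝ} {ε M L A : ℝ} (hf : IsRegular f ε M L A) (μ : Measure V)
    [IsProbabilityMeasure μ] : IsRegular (average μ f) ε M L A := by
  obtain ⟨w, hw, hwL, hwA⟩ := hf.taylor
  have hi : ∀ x, Integrable (fun z => f (x + z)) μ := fun x =>
    integrable_of_abs_le (hf.measurable.comp (measurable_const_add x)) (B := max |ε| |M|) fun z =>
      abs_le_max_abs_abs (hf.lower _) (hf.upper _)
  have hiw : ∀ x, Integrable (fun z => w (x + z)) μ := fun x =>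
    Integrable.of_bound (hw.comp (measurable_const_add x)).aestronglyMeasurable L
      (.of_forall fun z => hwL _)
  have key : ∀ {φ : V → ℝ} {C : ℝ}, (∀ z, |φ z| ≤ C) → |∫ z, φ z ∂μ| ≤ C := fun {φ C} h => by
    simpa using norm_integral_le_of_norm_le_const (μ := μ) (f := φ) (.of_forall h)
  refine ⟨measurable_average μ hf.measurable, hf.pos,
    fun x => (average_mem_Icc μ hf.measurable hf.lower hf.upper x).1,
    fun x => (average_mem_Icc μ hf.measurable hf.lower hf.upper x).2, fun x z => ?_,
    fun x => ∫ z, w (x + z) ∂μ, ?_, fun x => ?_, fun x z => ?_⟩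
  · unfold FRBL.average
    rw [← integral_sub (hi _) (hi _)]
    refine key fun y => ?_
    have := hf.lip (x + y) z
    rwa [show x + z + y = x + y + z by abel]
  · have : StronglyMeasurable (Function.uncurry fun x z : V => w (x + z)) :=
      (hw.comp measurable_add).stronglyMeasurable
    exact this.integral_prod_right.measurable
  · simpa using norm_integral_le_of_norm_le_const (μ := μ) (f := fun z => w (x + z))
      (.of_forall fun z => hwL _)
  · have : ⟪∫ y, w (x + y) ∂μ, z⟫ = ∫ y, ⟪w (x + y), z⟫ ∂μ := by
      rw [real_inner_comm, ← integral_inner (hiw x) z]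
      simp only [real_inner_comm]
    unfold FRBL.average
    have hsub : Integrable (fun y => f (x + z + y) - f (x + y)) μ := (hi _).sub (hi _)
    rw [this, ← integral_sub (hi _) (hi _), ← integral_sub hsub ((hiw x).inner_const z)]
    refine key fun y => ?_
    have := hwA (x + y) z
    rwa [show x + z + y = x + y + z by abel]

lemma abs_log_sub_log_sub_le {ε a b : ℝ} (hε : 0 < ε) (ha : ε ≤ a) (hb : ε ≤ b) :
    |Real.log b - Real.log a - (b - a) / a| ≤ (b - a) ^ 2 / ε ^ 2 := by
  have ha0 := hε.trans_le ha
  have hb0 := hε.trans_le hb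
  have h1 := Real.log_le_sub_one_of_pos (div_pos hb0 ha0)
  have h2 := Real.log_le_sub_one_of_pos (div_pos ha0 hb0)
  rw [Real.log_div hb0.ne' ha0.ne'] at h1
  rw [Real.log_div ha0.ne' hb0.ne'] at h2
  have e1 : b / a - 1 = (b - a) / a := by field_simp
  have e2 : (b - a) / a + (a / b - 1) = (b - a) ^ 2 / (a * b) := by field_simp; ring
  have h3 : (b - a) ^ 2 / (a * b) ≤ (b - a) ^ 2 / ε ^ 2 := by
    gcongr
    nlinarith
  have h4 : 0 ≤ (b - a) ^ 2 / ε ^ 2 := by positivity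
  rw [abs_le]
  constructor <;> linarith

lemma IsRegular.log_taylor {f : V → ℝ} {ε M L A : ℝ} (hf : IsRegular f ε M L A) (x : V) :
    ∃ u : V, ‖u‖ ≤ L / ε ∧ ∀ z, |Real.log (f (x + z)) - Real.log (f x) - ⟪u, z⟫| ≤
      (A / ε + L ^ 2 / ε ^ 2) * ‖z‖ ^ 2 := by
  obtain ⟨w, -, hwL, hwA⟩ := hf.taylor
  have hε := hf.pos
  have hx := hε.trans_le (hf.lower x)
  have hL : 0 ≤ L := (norm_nonneg _).trans (hwL x)
  refine ⟨(f x)⁻¹ • w x, ?_, fun z => ?_⟩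
  · rw [norm_smul, norm_inv, Real.norm_of_nonneg hx.le, inv_mul_eq_div]
    exact div_le_div₀ hL (hwL x) hε (hf.lower x)
  · have h1 := abs_log_sub_log_sub_le hε (hf.lower x) (hf.lower (x + z))
    have h2 : (f (x + z) - f x) ^ 2 ≤ L ^ 2 * ‖z‖ ^ 2 := by
      rw [← sq_abs, ← mul_pow]
      exact pow_le_pow_left₀ (abs_nonneg _) (hf.lip x z) 2
    have h3 : |(f (x + z) - f x) / f x - ⟪(f x)⁻¹ • w x, z⟫| ≤ A / ε * ‖z‖ ^ 2 := by
      rw [real_inner_smul_left, inv_mul_eq_div, ← sub_div, abs_div, abs_of_pos hx,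
        div_mul_eq_mul_div]
      exact div_le_div₀ ((abs_nonneg _).trans (hwA x z)) (hwA x z) hε (hf.lower x)
    have h4 : (f (x + z) - f x) ^ 2 / ε ^ 2 ≤ L ^ 2 / ε ^ 2 * ‖z‖ ^ 2 := by
      rw [div_mul_eq_mul_div]; gcongr
    have h5 := abs_add_le (Real.log (f (x + z)) - Real.log (f x) - (f (x + z) - f x) / f x)
      ((f (x + z) - f x) / f x - ⟪(f x)⁻¹ • w x, z⟫)
    rw [sub_add_sub_cancel] at h5
    linarith

lemma abs_log_le_max {ε M a : ℝ} (hε : 0 < ε) (h1 : ε ≤ a) (h2 : a ≤ M) :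
    |Real.log a| ≤ max |Real.log ε| |Real.log M| :=
  abs_le_max_abs_abs (Real.log_le_log hε h1) (Real.log_le_log (hε.trans_le h1) h2)

end Regular

section Coupling

lemma exists_comp_adjoint_eq {V : Type*} [NormedAddCommGroup V] [InnerProductSpace ℝ V]
    [FiniteDimensional ℝ V] {S : V →ₗ[ℝ] V} (hS : PosSemidef S) :
    ∃ T : EuclideanSpace ℝ (Fin (Module.finrank ℝ V)) →ₗ[ℝ] V, T ∘ₗ adjoint T = S := by
  obtain ⟨hs, hp⟩ := hS
  set b := hs.eigenvectorBasis rfl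
  set l := hs.eigenvalues rfl
  have hl : ∀ i, 0 ≤ l i := fun i => by
    have := hp (b i)
    rw [hs.apply_eigenvectorBasis rfl i] at this
    simpa [b, real_inner_smul_left, (b.orthonormal.1 i)] using this
  let T : EuclideanSpace ℝ (Fin (Module.finrank ℝ V)) →ₗ[ℝ] V :=
    ∑ i, (√(l i)) • (LinearMap.toSpanSingleton ℝ V (b i)).comp
      (EuclideanSpace.proj (𝕜 := ℝ) i).toLinearMap
  have hT : ∀ w, T w = ∑ i, √(l i) • w i • b i := fun w => by simp [T]
  refine ⟨T, b.toBasis.ext fun i => ?_⟩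
  rw [OrthonormalBasis.coe_toBasis, LinearMap.comp_apply, hs.apply_eigenvectorBasis rfl i]
  have h1 : adjoint T (b i) = EuclideanSpace.single i (√(l i)) := by
    refine ext_inner_right ℝ fun w => ?_
    rw [adjoint_inner_left, hT, inner_sum]
    simp only [real_inner_smul_right, b.inner_eq_ite]
    simp [EuclideanSpace.inner_single_left, mul_comm]
  rw [h1, hT]
  simp only [PiLp.single_apply, ite_smul, zero_smul, smul_ite, smul_zero,
    Finset.sum_ite_eq', Finset.mem_univ, if_true, smul_smul, Real.mul_self_sqrt (hl i)]
  simp [l, b]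

lemma norm_adjoint_comp_eq {V W H : Type*} [NormedAddCommGroup V] [InnerProductSpace ℝ V]
    [FiniteDimensional ℝ V] [NormedAddCommGroup W] [InnerProductSpace ℝ W]
    [FiniteDimensional ℝ W] [NormedAddCommGroup H] [InnerProductSpace ℝ H]
    [FiniteDimensional ℝ H] {S : V →ₗ[ℝ] V} {T : W →ₗ[ℝ] V} (hT : T ∘ₗ adjoint T = S)
    (Q : V →ₗ[ℝ] H) (hQ : ∀ t, ⟪S (adjoint Q t), adjoint Q t⟫ = ‖t‖ ^ 2) (t : H) :
    ‖adjoint (Q ∘ₗ T) t‖ = ‖t‖ := by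
  have := hQ t
  rw [← hT, comp_apply, ← adjoint_inner_right, real_inner_self_eq_norm_sq,
    ← comp_apply, ← adjoint_comp] at this
  exact (sq_eq_sq₀ (norm_nonneg _) (norm_nonneg _)).1 this

end Coupling

section Core

variable {k m : ℕ}
  {E : Fin k → Type*} {F : Fin m → Type*}
  [∀ i, NormedAddCommGroup (E i)] [∀ i, InnerProductSpace ℝ (E i)]
  [∀ i, FiniteDimensional ℝ (E i)]
  [∀ i, MeasurableSpace (E i)] [∀ i, BorelSpace (E i)]
  [∀ j, NormedAddCommGroup (F j)] [∀ j, InnerProductSpace ℝ (F j)]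
  [∀ j, FiniteDimensional ℝ (F j)]
  [∀ j, MeasurableSpace (F j)] [∀ j, BorelSpace (F j)]
  {c : Fin k → ℝ} {d : Fin m → ℝ}
  {Q : ∀ j, PiLp 2 E →ₗ[ℝ] F j}

lemma projL_apply (x : PiLp 2 E) (i : Fin k) : projL E i x = x i := rfl

lemma adjoint_projL (i : Fin k) : adjoint (projL E i) = singleL E i := by
  refine LinearMap.ext fun v => ext_inner_right ℝ fun x => ?_
  rw [adjoint_inner_left, PiLp.inner_apply, Finset.sum_eq_single i]
  · simp [singleL, toPi, projL]
  · intro j _ hj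
    simp [singleL, toPi, hj]
  · simp

lemma inner_Lam (x : PiLp 2 E) : ⟪Lam E c x, x⟫ = ∑ i, c i * ‖x i‖ ^ 2 := by
  simp only [Lam, LinearMap.sum_apply, sum_inner, LinearMap.smul_apply, real_inner_smul_left,
    ← adjoint_projL, LinearMap.comp_apply, adjoint_inner_left, real_inner_self_eq_norm_sq,
    projL_apply]

variable {W : Type*} [NormedAddCommGroup W] [InnerProductSpace ℝ W]
  [FiniteDimensional ℝ W] [MeasurableSpace W] [BorelSpace W] {T : W →ₗ[ℝ] PiLp 2 E}

lemma average_gaussScaled {V : Type*} [NormedAddCommGroup V] [InnerProductSpace ℝ V]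
    [FiniteDimensional ℝ V] [MeasurableSpace V] [BorelSpace V] {f : V → ℝ} (hf : Measurable f)
    (h : ℝ) (x : V) :
    average (gaussScaled V h) f x = ∫ z, f (x + √h • z) ∂stdGaussian V := by
  unfold average gaussScaled
  rw [integral_map (measurable_const_smul _).aemeasurable]
  exact (hf.comp (measurable_const_add x)).aestronglyMeasurable

lemma integral_stdGaussian_comp {V : Type*} [NormedAddCommGroup V] [InnerProductSpace ℝ V]
    [FiniteDimensional ℝ V] [MeasurableSpace V] [BorelSpace V] {φ : V → ℝ} (hφ : Measurable φ)
    {R : W →ₗ[ℝ] V} (hR : ∀ t, ‖adjoint R t‖ = ‖t‖) (p : V) (s : ℝ) :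
    ∫ z, φ (p + s • z) ∂stdGaussian V = ∫ w, φ (p + s • R w) ∂stdGaussian W := by
  have hm : Measurable fun z => φ (p + s • z) := hφ.comp (by fun_prop)
  rw [← map_stdGaussian_of_comp_adjoint R hR,
    integral_map (LinearMap.continuous_of_finiteDimensional R).measurable.aemeasurable
      hm.aestronglyMeasurable]

/-- One step of the heat flow preserves the pointwise inequality up to a quadratic error. -/
lemma sum_log_average_le (hc : ∀ i, 0 < c i) (hd : ∀ j, 0 < d j)
    (hQ : ∀ x : PiLp 2 E, (∑ j, d j * ⟪Q j x, Q j x⟫) ≤ ⟪Lam E c x, x⟫)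
    (hTE : ∀ i t, ‖adjoint (projL E i ∘ₗ T) t‖ = ‖t‖)
    (hTF : ∀ j t, ‖adjoint (Q j ∘ₗ T) t‖ = ‖t‖)
    {ε M L A : Fin k → ℝ} {f : ∀ i, E i → ℝ} (hf : ∀ i, IsRegular (f i) (ε i) (M i) (L i) (A i))
    {η N : ℝ} (hη : 0 < η) {g : ∀ j, F j → ℝ} (hg : ∀ j, Measurable (g j))
    (hgl : ∀ j y, η ≤ g j y) (hgu : ∀ j y, g j y ≤ N) {a : ℝ}
    (hyp : ∀ x : PiLp 2 E, ∑ i, c i * Real.log (f i (x i)) ≤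
      ∑ j, d j * Real.log (g j (Q j x)) + a)
    {h : ℝ} (hh : 0 ≤ h) (h1 : h ≤ 1) (x : PiLp 2 E) :
    ∑ i, c i * Real.log (average (gaussScaled (E i) h) (f i) (x i)) ≤
      ∑ j, d j * Real.log (average (gaussScaled (F j) h) (g j) (Q j x)) +
        (a + (∑ i, c i * stepConst (E i) (max |Real.log (ε i)| |Real.log (M i)|) (L i / ε i)
          (A i / ε i + L i ^ 2 / ε i ^ 2)) * h ^ 2) := by
  have hfm : ∀ i, Measurable fun x => Real.log (f i x) := fun i => (hf i).measurable.log
  have hgm : ∀ j, Measurable fun y => Real.log (g j y) := fun j => (hg j).log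
  have hfB : ∀ i x, |Real.log (f i x)| ≤ max |Real.log (ε i)| |Real.log (M i)| := fun i x =>
    abs_log_le_max (hf i).pos ((hf i).lower x) ((hf i).upper x)
  have hgB : ∀ j y, |Real.log (g j y)| ≤ max |Real.log η| |Real.log N| := fun j y =>
    abs_log_le_max hη (hgl j y) (hgu j y)
  choose u hu hut using fun i => (hf i).log_taylor (x i)
  set U : PiLp 2 E := WithLp.toLp 2 u with hU
  have hUi : ∀ i, U i = u i := fun i => rfl
  have hE : ∀ i, c i * Real.log (average (gaussScaled (E i) h) (f i) (x i)) ≤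
      c i * (∫ w, Real.log (f i ((x + h • U + √h • T w) i)) ∂stdGaussian W)
        - h / 2 * (c i * ‖u i‖ ^ 2) + c i * stepConst (E i) (max |Real.log (ε i)| |Real.log (M i)|)
          (L i / ε i) (A i / ε i + L i ^ 2 / ε i ^ 2) * h ^ 2 := fun i => by
    have := log_integral_exp_le (hfm i) (hfB i) (x i) (u i) (hu i) (hut i) hh h1
    simp only [Real.exp_log ((hf i).pos.trans_le ((hf i).lower _))] at this
    rw [← average_gaussScaled (hf i).measurable, integral_stdGaussian_comp (hfm i) (hTE i)] at this
    have := mul_le_mul_of_nonneg_left this (hc i).le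
    refine this.trans (le_of_eq ?_)
    simp only [LinearMap.comp_apply, projL_apply, PiLp.add_apply, PiLp.smul_apply, hUi]
    ring
  have hF : ∀ j, d j * (∫ w, Real.log (g j (Q j (x + h • U + √h • T w))) ∂stdGaussian W) ≤
      d j * Real.log (average (gaussScaled (F j) h) (g j) (Q j x)) +
        h / 2 * (d j * ⟪Q j U, Q j U⟫) := fun j => by
    have := integral_sub_le_log_integral_exp (hgm j) (hgB j) (Q j x) (Q j U) hh
    simp only [Real.exp_log (hη.trans_le (hgl _ _))] at this
    rw [← average_gaussScaled (hg j), integral_stdGaussian_comp (hgm j) (hTF j)] at this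
    have := mul_le_mul_of_nonneg_left this (hd j).le
    simp only [LinearMap.comp_apply] at this
    simp only [map_add, map_smul, real_inner_self_eq_norm_sq]
    linarith
  have hTm : ∀ i, Measurable fun w => (x + h • U + √h • T w) i := fun i => by
    have : Continuous (projL E i ∘ₗ T) := LinearMap.continuous_of_finiteDimensional _
    have h2 : (fun w => (x + h • U + √h • T w) i) =
        fun w => (x + h • U) i + √h • (projL E i ∘ₗ T) w := rfl
    rw [h2]
    fun_prop
  have hQm : ∀ j, Measurable fun w => Q j (x + h • U + √h • T w) := fun j => by
    have : Continuous (Q j ∘ₗ T) := LinearMap.continuous_of_finiteDimensional _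
    have h2 : (fun w => Q j (x + h • U + √h • T w)) =
        fun w => Q j (x + h • U) + √h • (Q j ∘ₗ T) w := by
      funext w; rw [map_add, map_smul]; rfl
    rw [h2]
    fun_prop
  have hiE : ∀ i, Integrable (fun w => Real.log (f i ((x + h • U + √h • T w) i)))
      (stdGaussian W) := fun i => integrable_of_abs_le ((hfm i).comp (hTm i)) fun w => hfB i _
  have hiF : ∀ j, Integrable (fun w => Real.log (g j (Q j (x + h • U + √h • T w))))
      (stdGaussian W) := fun j => integrable_of_abs_le ((hgm j).comp (hQm j)) fun w => hgB j _
  have hmid : ∑ i, c i * (∫ w, Real.log (f i ((x + h • U + √h • T w) i)) ∂stdGaussian W) ≤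
      ∑ j, d j * (∫ w, Real.log (g j (Q j (x + h • U + √h • T w))) ∂stdGaussian W) + a := by
    simp only [← integral_const_mul]
    rw [← integral_finsetSum _ fun i _ => (hiE i).const_mul _,
      ← integral_finsetSum _ fun j _ => (hiF j).const_mul _]
    have hia : ∫ _ : W, a ∂stdGaussian W = a := by simp
    rw [← hia, ← integral_add (integrable_finsetSum _ fun j _ => (hiF j).const_mul _)
      (integrable_const _)]
    refine integral_mono (integrable_finsetSum _ fun i _ => (hiE i).const_mul _)
      ((integrable_finsetSum _ fun j _ => (hiF j).const_mul _).add (integrable_const _))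
      fun w => ?_
    simpa using hyp (x + h • U + √h • T w)
  have h2 := Finset.sum_le_sum fun i (_ : i ∈ Finset.univ) => hE i
  have h3 := Finset.sum_le_sum fun j (_ : j ∈ Finset.univ) => hF j
  rw [Finset.sum_add_distrib, Finset.sum_sub_distrib, ← Finset.mul_sum, ← Finset.sum_mul] at h2
  rw [Finset.sum_add_distrib, ← Finset.mul_sum] at h3
  have h4 := hQ U
  rw [inner_Lam] at h4
  have h5 := mul_le_mul_of_nonneg_left h4 (div_nonneg hh zero_le_two)
  simp only [hUi] at h5
  linarith

lemma average_gaussScaled_add {V : Type*} [NormedAddCommGroup V] [InnerProductSpace ℝ V]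
    [FiniteDimensional ℝ V] [MeasurableSpace V] [BorelSpace V] {f : V → ℝ} (hf : Measurable f)
    {a b : ℝ} (ha : ∀ x, a ≤ f x) (hb : ∀ x, f x ≤ b) {s t : ℝ} (hs : 0 ≤ s) (ht : 0 ≤ t) :
    average (gaussScaled V (s + t)) f =
      average (gaussScaled V t) (average (gaussScaled V s) f) := by
  funext x
  rw [← gaussScaled_conv hs ht,
    average_average _ _ hf (C := max |a| |b|) fun x => abs_le_max_abs_abs (ha x) (hb x)]

lemma sum_log_average_iterate_le (hc : ∀ i, 0 < c i) (hd : ∀ j, 0 < d j)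
    (hQ : ∀ x : PiLp 2 E, (∑ j, d j * ⟪Q j x, Q j x⟫) ≤ ⟪Lam E c x, x⟫)
    (hTE : ∀ i t, ‖adjoint (projL E i ∘ₗ T) t‖ = ‖t‖)
    (hTF : ∀ j t, ‖adjoint (Q j ∘ₗ T) t‖ = ‖t‖)
    {ε M L A : Fin k → ℝ} {f : ∀ i, E i → ℝ} (hf : ∀ i, IsRegular (f i) (ε i) (M i) (L i) (A i))
    {η N : ℝ} (hη : 0 < η) {g : ∀ j, F j → ℝ} (hg : ∀ j, Measurable (g j))
    (hgl : ∀ j y, η ≤ g j y) (hgu : ∀ j y, g j y ≤ N)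
    (hyp : ∀ x : PiLp 2 E, ∑ i, c i * Real.log (f i (x i)) ≤ ∑ j, d j * Real.log (g j (Q j x)))
    {h : ℝ} (hh : 0 ≤ h) (h1 : h ≤ 1) (l : ℕ) (x : PiLp 2 E) :
    ∑ i, c i * Real.log (average (gaussScaled (E i) (l * h)) (f i) (x i)) ≤
      ∑ j, d j * Real.log (average (gaussScaled (F j) (l * h)) (g j) (Q j x)) +
        l * ((∑ i, c i * stepConst (E i) (max |Real.log (ε i)| |Real.log (M i)|) (L i / ε i)
          (A i / ε i + L i ^ 2 / ε i ^ 2)) * h ^ 2) := by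
  induction l generalizing x with
  | zero =>
    simp only [average, Nat.cast_zero, zero_mul, gaussScaled_zero, add_zero]
    convert hyp x using 5 with i _ j _
    · rw [integral_dirac, add_zero]
    · rw [integral_dirac, add_zero]
  | succ l ih =>
    have hl : 0 ≤ (l : ℝ) * h := by positivity
    simp only [Nat.cast_succ, add_one_mul]
    simp only [average_gaussScaled_add (hf _).measurable (hf _).lower (hf _).upper hl hh,
      average_gaussScaled_add (hg _) (hgl _) (hgu _) hl hh]
    exact sum_log_average_le hc hd hQ hTE hTF (fun i => (hf i).average _) hη
      (fun j => measurable_average _ (hg j))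
      (fun j y => (average_mem_Icc _ (hg j) (hgl j) (hgu j) y).1)
      (fun j y => (average_mem_Icc _ (hg j) (hgl j) (hgu j) y).2) ih hh h1 x

/-- The gaussian form of the inequality for regular inputs. -/
theorem sum_log_integral_le (hc : ∀ i, 0 < c i) (hd : ∀ j, 0 < d j)
    {S : PiLp 2 E →ₗ[ℝ] PiLp 2 E}
    (hS : S ∈ Coupling E (fun i => (LinearMap.id : E i →ₗ[ℝ] E i)))
    (hQS : ∀ j, ((Q j) ∘ₗ S) ∘ₗ LinearMap.adjoint (Q j) = LinearMap.id)
    (hQ : ∀ x : PiLp 2 E, (∑ j, d j * ⟪Q j x, Q j x⟫) ≤ ⟪Lam E c x, x⟫)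
    {ε M L A : Fin k → ℝ} {f : ∀ i, E i → ℝ} (hf : ∀ i, IsRegular (f i) (ε i) (M i) (L i) (A i))
    {η N : ℝ} (hη : 0 < η) {g : ∀ j, F j → ℝ} (hg : ∀ j, Measurable (g j))
    (hgl : ∀ j y, η ≤ g j y) (hgu : ∀ j y, g j y ≤ N)
    (hyp : ∀ x : PiLp 2 E, ∑ i, c i * Real.log (f i (x i)) ≤ ∑ j, d j * Real.log (g j (Q j x))) :
    ∑ i, c i * Real.log (∫ x, f i x ∂stdGaussian (E i)) ≤
      ∑ j, d j * Real.log (∫ y, g j y ∂stdGaussian (F j)) := by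
  obtain ⟨T, hT⟩ := exists_comp_adjoint_eq hS.1
  have hTE : ∀ i t, ‖adjoint (projL E i ∘ₗ T) t‖ = ‖t‖ := fun i =>
    norm_adjoint_comp_eq hT _ fun t => by
      rw [adjoint_projL, hS.2 i t, LinearMap.id_apply, real_inner_self_eq_norm_sq]
  have hTF : ∀ j t, ‖adjoint (Q j ∘ₗ T) t‖ = ‖t‖ := fun j =>
    norm_adjoint_comp_eq hT _ fun t => by
      rw [adjoint_inner_right, ← LinearMap.comp_apply, ← LinearMap.comp_apply, hQS j,
        LinearMap.id_apply, real_inner_self_eq_norm_sq]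
  set K := ∑ i, c i * stepConst (E i) (max |Real.log (ε i)| |Real.log (M i)|) (L i / ε i)
    (A i / ε i + L i ^ 2 / ε i ^ 2)
  have key : ∀ n : ℕ, ∑ i, c i * Real.log (∫ x, f i x ∂stdGaussian (E i)) ≤
      ∑ j, d j * Real.log (∫ y, g j y ∂stdGaussian (F j)) + K * (1 / ((n : ℝ) + 1)) := fun n => by
    have hn : (0 : ℝ) < (n : ℝ) + 1 := by positivity
    have := sum_log_average_iterate_le hc hd hQ hTE hTF hf hη hg hgl hgu hyp
      (h := 1 / ((n : ℝ) + 1)) (by positivity)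
      ((div_le_one hn).2 (by linarith [n.cast_nonneg (α := ℝ)]))
      (n + 1) 0
    have e : ((n + 1 : ℕ) : ℝ) * (1 / ((n : ℝ) + 1)) = 1 := by
      push_cast; field_simp
    rw [e, sq, mul_comm _ (K * _), ← mul_assoc, mul_assoc _ (1 / _), mul_comm (1 / _), e,
      mul_one] at this
    simpa only [gaussScaled_one, average, PiLp.zero_apply, map_zero, zero_add] using this
  have hlim := (tendsto_one_div_add_atTop_nhds_zero_nat (𝕜 := ℝ)).const_mul K
  simpa using ge_of_tendsto' (hlim.const_add (∑ j, d j * Real.log (∫ y, g j y ∂stdGaussian (F j))))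
    key

end Core

section Mollifier

variable {V : Type*} [NormedAddCommGroup V] [InnerProductSpace ℝ V]
  [FiniteDimensional ℝ V] [MeasurableSpace V] [BorelSpace V]

lemma exists_isRegular_of_contDiff {χ : V → ℝ} (hχ : ContDiff ℝ 2 χ) (hs : HasCompactSupport χ)
    {κ ε M : ℝ} (hε : 0 < ε) (h1 : ∀ x, ε ≤ κ + χ x) (h2 : ∀ x, κ + χ x ≤ M) :
    ∃ L A, IsRegular (fun x => κ + χ x) ε M L A := by
  obtain ⟨L, hL⟩ := (hs.fderiv ℝ).exists_bound_of_continuous (hχ.continuous_fderiv (by norm_num))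
  have hd : ContDiff ℝ 1 (fderiv ℝ χ) := hχ.fderiv_right (by norm_num)
  obtain ⟨A, hA⟩ := ContDiff.lipschitzWith_of_hasCompactSupport (hs.fderiv ℝ) hd (by norm_num)
  have hdiff : Differentiable ℝ χ := hχ.differentiable (by norm_num)
  refine ⟨L, A, (hχ.continuous.measurable.const_add κ), hε, h1, h2, fun x z => ?_,
    fun x => (InnerProductSpace.toDual ℝ V).symm (fderiv ℝ χ x), ?_, fun x => ?_, fun x z => ?_⟩
  · have := convex_univ.norm_image_sub_le_of_norm_fderiv_le (𝕜 := ℝ) (f := χ) (C := L)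
      (fun y _ => hdiff y) (fun y _ => hL y) (Set.mem_univ x) (Set.mem_univ (x + z))
    simpa using this
  · have := hd.continuous
    exact (Continuous.comp (InnerProductSpace.toDual ℝ V).symm.continuous this).measurable
  · simpa using hL x
  · have := (convex_closedBall x ‖z‖).norm_image_sub_le_of_norm_fderiv_le' (𝕜 := ℝ) (f := χ)
      (φ := fderiv ℝ χ x) (C := A * ‖z‖) (x := x) (y := x + z) (fun y _ => hdiff y)
      (fun y hy => (hA.norm_sub_le y x).trans (by
        gcongr; simpa [dist_eq_norm] using hy)) (by simp) (by simp [dist_eq_norm])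
    rw [InnerProductSpace.toDual_symm_apply]
    simpa [mul_assoc, sq] using this

/-- The probability measure with density a normalized bump function. -/
def bumpMeasure (φ : ContDiffBump (0 : V)) : Measure V :=
  volume.withDensity fun x => ENNReal.ofReal (φ.normed volume x)

instance isProbabilityMeasure_bumpMeasure (φ : ContDiffBump (0 : V)) :
    IsProbabilityMeasure (bumpMeasure φ) := by
  constructor
  rw [bumpMeasure, withDensity_apply _ .univ, setLIntegral_univ,
    ← ofReal_integral_eq_lintegral_ofReal φ.integrable_normed (.of_forall φ.nonneg_normed),
    φ.integral_normed, ENNReal.ofReal_one]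

lemma average_bumpMeasure (φ : ContDiffBump (0 : V)) (f : V → ℝ) (x : V) :
    average (bumpMeasure φ) f x =
      convolution (φ.normed volume) f (ContinuousLinearMap.lsmul ℝ ℝ) volume x := by
  unfold average bumpMeasure convolution
  rw [integral_withDensity_eq_integral_toReal_smul₀
    (φ.continuous_normed.measurable.ennreal_ofReal.aemeasurable)
    (.of_forall fun _ => ENNReal.ofReal_lt_top), ← integral_neg_eq_self]
  refine integral_congr_ae (.of_forall fun z => ?_)
  simp [ENNReal.toReal_ofReal (φ.nonneg_normed z), φ.normed_neg, sub_eq_add_neg]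

lemma exists_mollifier {f : V → ℝ} (hf : Measurable f) {ε M : ℝ} (hε : 0 < ε)
    (h1 : ∀ x, ε ≤ f x) (h2 : ∀ x, f x ≤ M)
    (hs : HasCompactSupport fun x => Real.log (f x) - Real.log ε) :
    ∃ μ : ℕ → Measure V, (∀ n, IsProbabilityMeasure (μ n)) ∧
      (∀ n, ∃ L A, IsRegular (fun x => Real.exp (average (μ n) (fun y => Real.log (f y)) x))
        ε M L A) ∧
      Filter.Tendsto (fun n => ∫ x, Real.exp (average (μ n) (fun y => Real.log (f y)) x)
        ∂stdGaussian V) Filter.atTop (nhds (∫ x, f x ∂stdGaussian V)) := by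
  have hpos : ∀ x, 0 < f x := fun x => hε.trans_le (h1 x)
  have hM : 0 < M := (hpos 0).trans_le (h2 0)
  have hlm : Measurable fun y => Real.log (f y) := hf.log
  have hll : ∀ x, Real.log ε ≤ Real.log (f x) := fun x => Real.log_le_log hε (h1 x)
  have hlu : ∀ x, Real.log (f x) ≤ Real.log M := fun x => Real.log_le_log (hpos x) (h2 x)
  have hlB : ∀ x, |Real.log (f x)| ≤ max |Real.log ε| |Real.log M| := fun x =>
    abs_log_le_max hε (h1 x) (h2 x)
  have hloc : LocallyIntegrable (fun y => Real.log (f y)) (volume : Measure V) :=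
    (locallyIntegrable_const (max |Real.log ε| |Real.log M|)).mono hlm.aestronglyMeasurable
      (.of_forall fun x => (hlB x).trans (le_abs_self _))
  have hloc' := hloc.sub (locallyIntegrable_const (Real.log ε))
  have hb : ∀ (μ : Measure V) [IsProbabilityMeasure μ] (x : V),
      ε ≤ Real.exp (average μ (fun y => Real.log (f y)) x) ∧
        Real.exp (average μ (fun y => Real.log (f y)) x) ≤ M := fun μ _ x => by
    obtain ⟨ha, hb⟩ := average_mem_Icc μ hlm hll hlu x
    rw [← Real.log_le_iff_le_exp hε, ← Real.le_log_iff_exp_le hM]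
    exact ⟨ha, hb⟩
  let φ : ℕ → ContDiffBump (0 : V) := fun n =>
    ⟨1 / ((n : ℝ) + 1), 2 * (1 / ((n : ℝ) + 1)), by positivity,
      lt_two_mul_self (by positivity)⟩
  refine ⟨fun n => bumpMeasure (φ n), fun n => inferInstance, fun n => ?_, ?_⟩
  · set ψ : V → ℝ := convolution ((φ n).normed volume) (fun x => Real.log (f x) - Real.log ε)
      (ContinuousLinearMap.lsmul ℝ ℝ) volume with hψ
    have hψs : HasCompactSupport ψ := (φ n).hasCompactSupport_normed.convolution _ hs
    have hψd : ContDiff ℝ 2 ψ :=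
      HasCompactSupport.contDiff_convolution_left (n := 2) _ (φ n).hasCompactSupport_normed
        (φ n).contDiff_normed hloc'
    have hav : ∀ x, average (bumpMeasure (φ n)) (fun y => Real.log (f y)) x =
        Real.log ε + ψ x := fun x => by
      rw [hψ, ← average_bumpMeasure]
      unfold average
      rw [integral_sub _ (integrable_const _)]
      · simp
      · exact integrable_of_abs_le (hlm.comp (measurable_const_add x)) fun z => hlB _
    have he : (fun x => Real.exp (average (bumpMeasure (φ n)) (fun y => Real.log (f y)) x)) =
        fun x => ε + ε * (Real.exp (ψ x) - 1) := by
      funext x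
      rw [hav, Real.exp_add, Real.exp_log hε]
      ring
    have hb' := hb (bumpMeasure (φ n))
    simp only [congrFun he] at hb'
    rw [he]
    refine exists_isRegular_of_contDiff (χ := fun x => ε * (Real.exp (ψ x) - 1)) ?_ ?_ hε
      (fun x => (hb' x).1) (fun x => (hb' x).2)
    · exact contDiff_const.mul (hψd.exp.sub contDiff_const)
    · exact hψs.comp_left (g := fun t => ε * (Real.exp t - 1)) (by simp)
  · have hlim := ContDiffBump.ae_convolution_tendsto_right_of_locallyIntegrable (φ := φ)
      (l := Filter.atTop) (K := 2) (μ := (volume : Measure V))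
      (by simpa [φ] using (tendsto_one_div_add_atTop_nhds_zero_nat (𝕜 := ℝ)).const_mul 2)
      (.of_forall fun n => le_rfl) hloc
    have hac : stdGaussian V ≪ volume := withDensity_absolutelyContinuous _ _
    refine tendsto_integral_of_dominated_convergence (fun _ => M) (fun n => ?_)
      (integrable_const _) (fun n => .of_forall fun x => ?_) ?_
    · exact (measurable_average _ hlm).exp.aestronglyMeasurable
    · rw [Real.norm_of_nonneg (Real.exp_nonneg _)]
      exact (hb _ x).2
    · filter_upwards [hac.ae_le hlim] with x hx
      simp only [average_bumpMeasure]
      have := (Real.continuous_exp.tendsto _).comp hx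
      rwa [Real.exp_log (hpos x)] at this

end Mollifier

section Smoothing

variable {k m : ℕ}
  {E : Fin k → Type*} {F : Fin m → Type*}
  [∀ i, NormedAddCommGroup (E i)] [∀ i, InnerProductSpace ℝ (E i)]
  [∀ i, FiniteDimensional ℝ (E i)]
  [∀ i, MeasurableSpace (E i)] [∀ i, BorelSpace (E i)]
  [∀ j, NormedAddCommGroup (F j)] [∀ j, InnerProductSpace ℝ (F j)]
  [∀ j, FiniteDimensional ℝ (F j)]
  [∀ j, MeasurableSpace (F j)] [∀ j, BorelSpace (F j)]
  {c : Fin k → ℝ} {d : Fin m → ℝ}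
  {Q : ∀ j, PiLp 2 E →ₗ[ℝ] F j}

lemma continuous_comp_toLp (j : Fin m) : Continuous fun z : ∀ i, E i => Q j (WithLp.toLp 2 z) :=
  LinearMap.continuous_of_finiteDimensional ((Q j).comp (toPi E).symm.toLinearMap)

/-- Averaging both sides of the pointwise inequality. -/
lemma exists_sum_average_log_le (hd : ∀ j, 0 < d j) (μ : ∀ i, Measure (E i))
    [∀ i, IsProbabilityMeasure (μ i)]
    {ε M : ℝ} (hε : 0 < ε) {f : ∀ i, E i → ℝ} (hf : ∀ i, Measurable (f i))
    (hfl : ∀ i x, ε ≤ f i x) (hfu : ∀ i x, f i x ≤ M)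
    {η N : ℝ} (hη : 0 < η) {g : ∀ j, F j → ℝ} (hg : ∀ j, Measurable (g j))
    (hgl : ∀ j y, η ≤ g j y) (hgu : ∀ j y, g j y ≤ N)
    (hyp : ∀ x : PiLp 2 E, ∑ i, c i * Real.log (f i (x i)) ≤ ∑ j, d j * Real.log (g j (Q j x))) :
    ∃ ν : ∀ j, Measure (F j), (∀ j, IsProbabilityMeasure (ν j)) ∧ ∀ x : PiLp 2 E,
      ∑ i, c i * average (μ i) (fun y => Real.log (f i y)) (x i) ≤
        ∑ j, d j * Real.log (average (ν j) (g j) (Q j x)) := by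
  have hm : ∀ j, Measurable fun z : ∀ i, E i => Q j (WithLp.toLp 2 z) := fun j =>
    (continuous_comp_toLp j).measurable
  have hfm : ∀ i, Measurable fun x => Real.log (f i x) := fun i => (hf i).log
  have hgm : ∀ j, Measurable fun y => Real.log (g j y) := fun j => (hg j).log
  have hgB : ∀ j y, |Real.log (g j y)| ≤ max |Real.log η| |Real.log N| := fun j y =>
    abs_log_le_max hη (hgl j y) (hgu j y)
  refine ⟨fun j => (Measure.pi μ).map fun z => Q j (WithLp.toLp 2 z),
    fun j => Measure.isProbabilityMeasure_map (hm j).aemeasurable, fun x => ?_⟩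
  have hE : ∀ i, average (μ i) (fun y => Real.log (f i y)) (x i) =
      ∫ z, Real.log (f i (x i + z i)) ∂Measure.pi μ := fun i => by
    unfold average
    rw [← (measurePreserving_eval μ i).map_eq, integral_map (measurable_pi_apply i).aemeasurable]
    exact ((hfm i).comp (measurable_const_add _)).aestronglyMeasurable
  have hiF : ∀ j, Integrable (fun z : ∀ i, E i => Real.log (g j (Q j x + Q j (WithLp.toLp 2 z))))
      (Measure.pi μ) := fun j =>
    integrable_of_abs_le ((hgm j).comp ((hm j).const_add _)) fun z => hgB j _
  have hF : ∀ j, ∫ z, Real.log (g j (Q j x + Q j (WithLp.toLp 2 z))) ∂Measure.pi μ ≤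
      Real.log (average ((Measure.pi μ).map fun z => Q j (WithLp.toLp 2 z)) (g j) (Q j x)) :=
      fun j => by
    have hexp : ∀ z : ∀ i, E i, Real.exp (Real.log (g j (Q j x + Q j (WithLp.toLp 2 z)))) =
        g j (Q j x + Q j (WithLp.toLp 2 z)) := fun z => Real.exp_log (hη.trans_le (hgl _ _))
    have := integral_le_log_integral_exp (hiF j) (by
      simp only [hexp]
      exact integrable_of_abs_le ((hg j).comp ((hm j).const_add _)) fun z =>
        abs_le_max_abs_abs (hgl j _) (hgu j _))
    simp only [hexp] at this
    unfold average
    rwa [integral_map (hm j).aemeasurable]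
    exact ((hg j).comp (measurable_const_add _)).aestronglyMeasurable
  have hiE : ∀ i, Integrable (fun z : ∀ i, E i => Real.log (f i (x i + z i))) (Measure.pi μ) :=
    fun i => integrable_of_abs_le ((hfm i).comp ((measurable_pi_apply i).const_add _))
      fun z => abs_log_le_max hε (hfl i _) (hfu i _)
  refine le_trans ?_ (Finset.sum_le_sum fun j _ => mul_le_mul_of_nonneg_left (hF j) (hd j).le)
  simp only [hE, ← integral_const_mul]
  rw [← integral_finsetSum _ fun i _ => (hiE i).const_mul _,
    ← integral_finsetSum _ fun j _ => (hiF j).const_mul _]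
  refine integral_mono (integrable_finsetSum _ fun i _ => (hiE i).const_mul _)
    (integrable_finsetSum _ fun j _ => (hiF j).const_mul _) fun z => ?_
  simpa using hyp (x + WithLp.toLp 2 z)

lemma integral_average_le {V : Type*} [NormedAddCommGroup V] [InnerProductSpace ℝ V]
    [FiniteDimensional ℝ V] [MeasurableSpace V] [BorelSpace V] (ν : Measure V)
    [IsProbabilityMeasure ν] {g : V → ℝ} (hg : Measurable g) {a b : ℝ} (ha : ∀ x, a ≤ g x)
    (hb : ∀ x, g x ≤ b) {J : ℝ} (hJ : ∀ z, ∫ y, g (y + z) ∂stdGaussian V ≤ J) :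
    ∫ y, average ν g y ∂stdGaussian V ≤ J := by
  have hi : Integrable (Function.uncurry fun y z => g (y + z)) ((stdGaussian V).prod ν) :=
    integrable_of_abs_le (hg.comp measurable_add) fun p => abs_le_max_abs_abs (ha _) (hb _)
  unfold average
  rw [integral_integral_swap hi]
  simpa using integral_mono hi.integral_prod_right (integrable_const J) hJ

/-- The gaussian form of the inequality for measurable inputs bounded away from zero and
infinity. -/
lemma sum_log_integral_le_of_bounded (hc : ∀ i, 0 < c i) (hd : ∀ j, 0 < d j)
    {S : PiLp 2 E →ₗ[ℝ] PiLp 2 E}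
    (hS : S ∈ Coupling E (fun i => (LinearMap.id : E i →ₗ[ℝ] E i)))
    (hQS : ∀ j, ((Q j) ∘ₗ S) ∘ₗ LinearMap.adjoint (Q j) = LinearMap.id)
    (hQ : ∀ x : PiLp 2 E, (∑ j, d j * ⟪Q j x, Q j x⟫) ≤ ⟪Lam E c x, x⟫)
    {ε M : ℝ} (hε : 0 < ε) {f : ∀ i, E i → ℝ} (hf : ∀ i, Measurable (f i))
    (hfl : ∀ i x, ε ≤ f i x) (hfu : ∀ i x, f i x ≤ M)
    (hs : ∀ i, HasCompactSupport fun x => Real.log (f i x) - Real.log ε)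
    {η N : ℝ} (hη : 0 < η) {g : ∀ j, F j → ℝ} (hg : ∀ j, Measurable (g j))
    (hgl : ∀ j y, η ≤ g j y) (hgu : ∀ j y, g j y ≤ N)
    (hyp : ∀ x : PiLp 2 E, ∑ i, c i * Real.log (f i (x i)) ≤ ∑ j, d j * Real.log (g j (Q j x)))
    {J : Fin m → ℝ} (hJ : ∀ j z, ∫ y, g j (y + z) ∂stdGaussian (F j) ≤ J j) :
    ∑ i, c i * Real.log (∫ x, f i x ∂stdGaussian (E i)) ≤ ∑ j, d j * Real.log (J j) := by
  choose μ hμ hreg hlim using fun i => exists_mollifier (hf i) hε (hfl i) (hfu i) (hs i)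
  have hpos : ∀ i, 0 < ∫ x, f i x ∂stdGaussian (E i) := fun i => by
    have := integral_mono (μ := stdGaussian (E i)) (integrable_const ε)
      (integrable_of_abs_le (hf i) fun x => abs_le_max_abs_abs (hfl i x) (hfu i x)) (hfl i)
    simp only [integral_const, probReal_univ, one_smul] at this
    exact hε.trans_le this
  refine le_of_tendsto' (tendsto_finsetSum _ fun i _ =>
    (((Real.continuousAt_log (hpos i).ne').tendsto.comp (hlim i)).const_mul (c i))) fun n => ?_
  have hμn : ∀ i, IsProbabilityMeasure (μ i n) := fun i => hμ i n
  obtain ⟨ν, hν, hle⟩ :=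
    exists_sum_average_log_le hd (fun i => μ i n) hε hf hfl hfu hη hg hgl hgu hyp
  choose L A hLA using fun i => hreg i n
  refine (sum_log_integral_le hc hd hS hQS hQ hLA hη
    (fun j => measurable_average (ν j) (hg j))
    (fun j y => (average_mem_Icc (ν j) (hg j) (hgl j) (hgu j) y).1)
    (fun j y => (average_mem_Icc (ν j) (hg j) (hgl j) (hgu j) y).2)
    (by simpa only [Real.log_exp] using hle)).trans ?_
  refine Finset.sum_le_sum fun j _ => mul_le_mul_of_nonneg_left (Real.log_le_log ?_ ?_) (hd j).le
  · have := integral_mono (μ := stdGaussian (F j)) (integrable_const η)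
      (integrable_of_abs_le (measurable_average (ν j) (hg j)) fun x => abs_le_max_abs_abs
        (average_mem_Icc (ν j) (hg j) (hgl j) (hgu j) x).1
        (average_mem_Icc (ν j) (hg j) (hgl j) (hgu j) x).2)
      (fun y => (average_mem_Icc (ν j) (hg j) (hgl j) (hgu j) y).1)
    simp only [integral_const, probReal_univ, one_smul] at this
    exact hη.trans_le this
  · exact integral_average_le (ν j) (hg j) (hgl j) (hgu j) (hJ j)

end Smoothing

section Truncation

lemma sum_mul_log_trunc_le {k m : ℕ} {c : Fin k → ℝ} {d : Fin m → ℝ} (hc : ∀ i, 0 < c i)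
    (hd : ∀ j, 0 < d j) {a b t : ℝ} (ha : 0 ≤ a) (hb : 0 ≤ b) (hat : a ≤ t)
    (hct : ∀ i, (∑ i, c i) * a + (∑ j, d j) * b ≤ c i * t)
    (hdt : ∀ j, (∑ i, c i) * a + (∑ j, d j) * b ≤ d j * t) {p : Fin k → ℝ} {q : Fin m → ℝ}
    (hp : ∀ i, p i ≤ Real.exp a) (hq : ∀ j, 0 ≤ q j)
    (hpq : ∏ i, p i ^ c i ≤ ∏ j, q j ^ d j) :
    ∑ i, c i * Real.log (max (p i) (Real.exp (-t))) ≤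
      ∑ j, d j * Real.log (min (max (q j) (Real.exp (-b))) (Real.exp t)) := by
  have ht : 0 ≤ t := ha.trans hat
  have hpu : ∀ i, Real.log (max (p i) (Real.exp (-t))) ≤ a := fun i => by
    rw [Real.log_le_iff_le_exp (lt_max_of_lt_right (Real.exp_pos _))]
    exact max_le (hp i) (Real.exp_le_exp.2 (by linarith))
  have hPu : ∑ i, c i * Real.log (max (p i) (Real.exp (-t))) ≤ (∑ i, c i) * a := by
    rw [Finset.sum_mul]
    exact Finset.sum_le_sum fun i _ => mul_le_mul_of_nonneg_left (hpu i) (hc i).le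
  have hql : ∀ j, -b ≤ Real.log (min (max (q j) (Real.exp (-b))) (Real.exp t)) := fun j => by
    rw [Real.le_log_iff_exp_le (lt_min (lt_max_of_lt_right (Real.exp_pos _)) (Real.exp_pos _))]
    exact le_min (le_max_right _ _) (Real.exp_le_exp.2 (by linarith))
  have hQl : -((∑ j, d j) * b) ≤
      ∑ j, d j * Real.log (min (max (q j) (Real.exp (-b))) (Real.exp t)) := by
    rw [← mul_neg, Finset.sum_mul]
    exact Finset.sum_le_sum fun j _ => mul_le_mul_of_nonneg_left (hql j) (hd j).le
  by_cases h1 : ∃ i, p i ≤ Real.exp (-t)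
  · obtain ⟨i, hi⟩ := h1
    have : ∑ i, c i * Real.log (max (p i) (Real.exp (-t))) ≤ (∑ i, c i) * a - c i * t := by
      rw [← Finset.add_sum_erase _ _ (Finset.mem_univ i), max_eq_right hi, Real.log_exp]
      have h2 : ∑ l ∈ Finset.univ.erase i, c l * Real.log (max (p l) (Real.exp (-t))) ≤
          ∑ l, c l * a :=
        (Finset.sum_le_sum fun l _ => mul_le_mul_of_nonneg_left (hpu l) (hc l).le).trans
          (Finset.sum_le_sum_of_subset_of_nonneg (Finset.erase_subset _ _)
            fun l _ _ => mul_nonneg (hc l).le ha)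
      rw [← Finset.sum_mul] at h2
      linarith
    linarith [hct i]
  push Not at h1
  by_cases h2 : ∃ j, Real.exp t ≤ q j
  · obtain ⟨j, hj⟩ := h2
    have : d j * t - (∑ j, d j) * b ≤
        ∑ j, d j * Real.log (min (max (q j) (Real.exp (-b))) (Real.exp t)) := by
      rw [← Finset.add_sum_erase _ (fun l => d l * Real.log _) (Finset.mem_univ j),
        min_eq_right (hj.trans (le_max_left _ _)), Real.log_exp]
      have h2 : ∑ l, d l * (-b) ≤ ∑ l ∈ Finset.univ.erase j,
          d l * Real.log (min (max (q l) (Real.exp (-b))) (Real.exp t)) := by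
        refine le_trans ?_ (Finset.sum_le_sum fun l _ =>
          mul_le_mul_of_nonneg_left (hql l) (hd l).le)
        rw [← Finset.add_sum_erase _ _ (Finset.mem_univ j)]
        linarith [mul_nonneg (hd j).le hb]
      rw [← Finset.sum_mul] at h2
      linarith
    linarith [hdt j]
  push Not at h2
  have hp0 : ∀ i, 0 < p i := fun i => (Real.exp_pos _).trans (h1 i)
  have hPpos : 0 < ∏ i, p i ^ c i := Finset.prod_pos fun i _ => Real.rpow_pos_of_pos (hp0 i) _
  have hq0 : ∀ j, 0 < q j := fun j => (hq j).lt_of_ne fun h => by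
    have : ∏ j, q j ^ d j = 0 := Finset.prod_eq_zero (Finset.mem_univ j) (by
      rw [← h, Real.zero_rpow (hd j).ne'])
    linarith
  have h3 := Real.log_le_log hPpos hpq
  rw [Real.log_prod fun i _ => (Real.rpow_pos_of_pos (hp0 i) _).ne',
    Real.log_prod fun j _ => (Real.rpow_pos_of_pos (hq0 j) _).ne'] at h3
  simp only [Real.log_rpow (hp0 _), Real.log_rpow (hq0 _)] at h3
  simp only [max_eq_left (h1 _).le]
  refine h3.trans (Finset.sum_le_sum fun j _ =>
    mul_le_mul_of_nonneg_left (Real.log_le_log (hq0 j) ?_) (hd j).le)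
  exact le_min (le_max_left _ _) (h2 j).le

end Truncation

section CompactSupport

variable {k m : ℕ}
  {E : Fin k → Type*} {F : Fin m → Type*}
  [∀ i, NormedAddCommGroup (E i)] [∀ i, InnerProductSpace ℝ (E i)]
  [∀ i, FiniteDimensional ℝ (E i)]
  [∀ i, MeasurableSpace (E i)] [∀ i, BorelSpace (E i)]
  [∀ j, NormedAddCommGroup (F j)] [∀ j, InnerProductSpace ℝ (F j)]
  [∀ j, FiniteDimensional ℝ (F j)]
  [∀ j, MeasurableSpace (F j)] [∀ j, BorelSpace (F j)]
  {c : Fin k → ℝ} {d : Fin m → ℝ}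
  {Q : ∀ j, PiLp 2 E →ₗ[ℝ] F j}

lemma gaussDensity_le {V : Type*} [NormedAddCommGroup V] [InnerProductSpace ℝ V] (x : V) :
    gaussDensity V x ≤ (2 * Real.pi) ^ (-(Module.finrank ℝ V : ℝ) / 2) := by
  refine mul_le_of_le_one_right (by positivity) (Real.exp_le_one_iff.2 ?_)
  have := sq_nonneg ‖x‖
  linarith

lemma integral_trunc_stdGaussian_le {V : Type*} [NormedAddCommGroup V] [InnerProductSpace ℝ V]
    [FiniteDimensional ℝ V] [MeasurableSpace V] [BorelSpace V] {g : V → ℝ} (hg : Measurable g)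
    (hg0 : ∀ y, 0 ≤ g y) (hi : Integrable g) {η N : ℝ} (hη : 0 < η) (hN : η ≤ N) (z : V) :
    ∫ y, min (max (g (y + z)) η) N ∂stdGaussian V ≤
      η + (2 * Real.pi) ^ (-(Module.finrank ℝ V : ℝ) / 2) * ∫ y, g y := by
  set K := (2 * Real.pi) ^ (-(Module.finrank ℝ V : ℝ) / 2)
  have hl : ∀ y, η ≤ min (max (g (y + z)) η) N := fun y => le_min (le_max_right _ _) hN
  have hm : Measurable fun y => min (max (g (y + z)) η) N :=
    ((hg.comp (measurable_add_const z)).max measurable_const).min measurable_const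
  have h1 : ∫ y, min (max (g (y + z)) η) N ∂stdGaussian V =
      η + ∫ y, (min (max (g (y + z)) η) N - η) ∂stdGaussian V := by
    rw [integral_sub (integrable_of_abs_le hm fun y =>
      abs_le_max_abs_abs (hl y) (min_le_right _ _)) (integrable_const _)]
    simp
  have h2 : K * ∫ y, g y = ∫ y, K * g (y + z) := by
    rw [integral_const_mul, integral_add_right_eq_self g]
  rw [h1, h2, integral_stdGaussian]
  refine add_le_add_right (integral_mono_of_nonneg (.of_forall fun y =>
    mul_nonneg (gaussDensity_pos y).le (sub_nonneg.2 (hl y)))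
    ((hi.comp_add_right z).const_mul K) (.of_forall fun y => ?_)) η
  refine mul_le_mul (gaussDensity_le y) ?_ (sub_nonneg.2 (hl y)) (by positivity)
  have : min (max (g (y + z)) η) N ≤ g (y + z) + η :=
    (min_le_left _ _).trans (max_le (by linarith) (by linarith [hg0 (y + z)]))
  linarith

/-- The inequality for bounded compactly supported `f i` and integrable `g j`, with gaussian
weights on the left-hand side. -/
lemma prod_integral_stdGaussian_le (hc : ∀ i, 0 < c i) (hd : ∀ j, 0 < d j)
    {S : PiLp 2 E →ₗ[ℝ] PiLp 2 E}
    (hS : S ∈ Coupling E (fun i => (LinearMap.id : E i →ₗ[ℝ] E i)))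
    (hQS : ∀ j, ((Q j) ∘ₗ S) ∘ₗ LinearMap.adjoint (Q j) = LinearMap.id)
    (hQ : ∀ x : PiLp 2 E, (∑ j, d j * ⟪Q j x, Q j x⟫) ≤ ⟪Lam E c x, x⟫)
    {a : ℝ} (ha : 0 ≤ a) {f : ∀ i, E i → ℝ} (hf : ∀ i, Measurable (f i))
    (hf0 : ∀ i x, 0 ≤ f i x) (hfa : ∀ i x, f i x ≤ Real.exp a) (hs : ∀ i, HasCompactSupport (f i))
    {g : ∀ j, F j → ℝ} (hg : ∀ j, Measurable (g j)) (hg0 : ∀ j y, 0 ≤ g j y)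
    (hgi : ∀ j, Integrable (g j))
    (hyp : ∀ x : PiLp 2 E, ∏ i, f i (x i) ^ c i ≤ ∏ j, g j (Q j x) ^ d j) :
    ∏ i, (∫ x, f i x ∂stdGaussian (E i)) ^ c i ≤
      ∏ j, ((2 * Real.pi) ^ (-(Module.finrank ℝ (F j) : ℝ) / 2) * ∫ y, g j y) ^ d j := by
  have hI0 : ∀ i, 0 ≤ ∫ x, f i x ∂stdGaussian (E i) := fun i => integral_nonneg (hf0 i)
  have hJ0 : ∀ j, 0 ≤ (2 * Real.pi) ^ (-(Module.finrank ℝ (F j) : ℝ) / 2) * ∫ y, g j y :=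
    fun j => mul_nonneg (by positivity) (integral_nonneg (hg0 j))
  by_cases hz : ∃ i, ∫ x, f i x ∂stdGaussian (E i) = 0
  · obtain ⟨i, hi⟩ := hz
    rw [Finset.prod_eq_zero (Finset.mem_univ i) (by rw [hi, Real.zero_rpow (hc i).ne'])]
    exact Finset.prod_nonneg fun j _ => Real.rpow_nonneg (hJ0 j) _
  push Not at hz
  have hI : ∀ i, 0 < ∫ x, f i x ∂stdGaussian (E i) := fun i => (hI0 i).lt_of_ne (hz i).symm
  have key : ∀ b : ℕ, ∏ i, (∫ x, f i x ∂stdGaussian (E i)) ^ c i ≤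
      ∏ j, (Real.exp (-b) +
        (2 * Real.pi) ^ (-(Module.finrank ℝ (F j) : ℝ) / 2) * ∫ y, g j y) ^ d j := fun b => by
    obtain ⟨t, hat, hct, hdt⟩ : ∃ t : ℝ, a ≤ t ∧
        (∀ i, (∑ i, c i) * a + (∑ j, d j) * b ≤ c i * t) ∧
        ∀ j, (∑ i, c i) * a + (∑ j, d j) * b ≤ d j * t := by
      refine Filter.Eventually.exists (f := Filter.atTop) ?_
      refine (Filter.eventually_ge_atTop a).and
        ((Filter.eventually_all.2 fun i => ?_).and (Filter.eventually_all.2 fun j => ?_))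
      · exact (Filter.tendsto_id.const_mul_atTop (hc i)).eventually_ge_atTop _
      · exact (Filter.tendsto_id.const_mul_atTop (hd j)).eventually_ge_atTop _
    have hb : (0 : ℝ) ≤ b := b.cast_nonneg
    have hexp : Real.exp (-b) ≤ Real.exp t := Real.exp_le_exp.2 (by linarith)
    have hat' : Real.exp (-t) ≤ Real.exp a := Real.exp_le_exp.2 (by linarith)
    have hfm : ∀ i, Measurable fun x => max (f i x) (Real.exp (-t)) :=
      fun i => (hf i).max measurable_const
    have := sum_log_integral_le_of_bounded hc hd hS hQS hQ (Real.exp_pos (-t))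
      (f := fun i x => max (f i x) (Real.exp (-t))) hfm
      (fun i x => le_max_right _ _) (fun i x => max_le (hfa i x) hat')
      (fun i => (hs i).comp_left
        (g := fun s => Real.log (max s (Real.exp (-t))) - Real.log (Real.exp (-t)))
        (by rw [max_eq_right (Real.exp_pos _).le, sub_self]))
      (Real.exp_pos (-b)) (g := fun j y => min (max (g j y) (Real.exp (-b))) (Real.exp t))
      (fun j => ((hg j).max measurable_const).min measurable_const)
      (fun j y => le_min (le_max_right _ _) hexp) (fun j y => min_le_right _ _)
      (fun x => sum_mul_log_trunc_le hc hd ha hb hat hct hdt (fun i => hfa i _)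
        (fun j => hg0 j _) (hyp x))
      (fun j z => integral_trunc_stdGaussian_le (hg j) (hg0 j) (hgi j) (Real.exp_pos _) hexp z)
    have hJ : ∀ j, 0 < Real.exp (-b) +
        (2 * Real.pi) ^ (-(Module.finrank ℝ (F j) : ℝ) / 2) * ∫ y, g j y := fun j =>
      add_pos_of_pos_of_nonneg (Real.exp_pos _) (hJ0 j)
    rw [← Real.log_le_log_iff (Finset.prod_pos fun i _ => Real.rpow_pos_of_pos (hI i) _)
      (Finset.prod_pos fun j _ => Real.rpow_pos_of_pos (hJ j) _),
      Real.log_prod fun i _ => (Real.rpow_pos_of_pos (hI i) _).ne',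
      Real.log_prod fun j _ => (Real.rpow_pos_of_pos (hJ j) _).ne']
    simp only [Real.log_rpow (hI _), Real.log_rpow (hJ _)]
    refine le_trans (Finset.sum_le_sum fun i _ =>
      mul_le_mul_of_nonneg_left (Real.log_le_log (hI i) ?_) (hc i).le) this
    exact integral_mono (integrable_of_abs_le (hf i) fun x =>
      (abs_of_nonneg (hf0 i x)).trans_le (hfa i x))
      (integrable_of_abs_le (hfm i) fun x => abs_le_max_abs_abs (le_max_right _ _)
        (max_le (hfa i x) hat')) fun x => le_max_left _ _
  refine ge_of_tendsto' (x := Filter.atTop) (tendsto_finsetProd _ fun j _ => ?_) key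
  have h0 : Filter.Tendsto (fun b : ℕ => Real.exp (-(b : ℝ))) Filter.atTop (nhds 0) :=
    Real.tendsto_exp_neg_atTop_nhds_zero.comp tendsto_natCast_atTop_atTop
  have := h0.add_const ((2 * Real.pi) ^ (-(Module.finrank ℝ (F j) : ℝ) / 2) * ∫ y, g j y)
  rw [zero_add] at this
  exact this.rpow_const (.inr (hd j).le)

/-- Rescaled version of `prod_integral_stdGaussian_le`. -/
lemma prod_integral_exp_mul_le (hc : ∀ i, 0 < c i) (hd : ∀ j, 0 < d j)
    (hscal : ScalingCond E F c d) {S : PiLp 2 E →ₗ[ℝ] PiLp 2 E}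
    (hS : S ∈ Coupling E (fun i => (LinearMap.id : E i →ₗ[ℝ] E i)))
    (hQS : ∀ j, ((Q j) ∘ₗ S) ∘ₗ LinearMap.adjoint (Q j) = LinearMap.id)
    (hQ : ∀ x : PiLp 2 E, (∑ j, d j * ⟪Q j x, Q j x⟫) ≤ ⟪Lam E c x, x⟫)
    {a : ℝ} (ha : 0 ≤ a) {f : ∀ i, E i → ℝ} (hf : ∀ i, Measurable (f i))
    (hf0 : ∀ i x, 0 ≤ f i x) (hfa : ∀ i x, f i x ≤ Real.exp a) (hs : ∀ i, HasCompactSupport (f i))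
    {g : ∀ j, F j → ℝ} (hg : ∀ j, Measurable (g j)) (hg0 : ∀ j y, 0 ≤ g j y)
    (hgi : ∀ j, Integrable (g j))
    (hyp : ∀ x : PiLp 2 E, ∏ i, f i (x i) ^ c i ≤ ∏ j, g j (Q j x) ^ d j) {R : ℝ} (hR : 0 < R) :
    ∏ i, (∫ x, Real.exp (-‖R⁻¹ • x‖ ^ 2 / 2) * f i x) ^ c i ≤ ∏ j, (∫ y, g j y) ^ d j := by
  have h := prod_integral_stdGaussian_le hc hd hS hQS hQ ha (f := fun i x => f i (R • x))
    (fun i => (hf i).comp (measurable_const_smul R)) (fun i x => hf0 i _) (fun i x => hfa i _)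
    (fun i => (hs i).comp_smul hR.ne') (g := fun j y => g j (R • y))
    (fun j => (hg j).comp (measurable_const_smul R)) (fun j x => hg0 j _)
    (fun j => (hgi j).comp_smul hR.ne') (fun x => by simpa using hyp (R • x))
  set τ := (2 * Real.pi) ^ (-(1 : ℝ) / 2) * R⁻¹ with hτ
  have hτ0 : 0 < τ := by positivity
  have hτn : ∀ n : ℕ, (2 * Real.pi) ^ (-(n : ℝ) / 2) * (R ^ n)⁻¹ = τ ^ (n : ℝ) := fun n => by
    rw [hτ, Real.rpow_natCast, mul_pow, inv_pow, ← Real.rpow_natCast ((2 * Real.pi) ^ _),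
      ← Real.rpow_mul (by positivity)]
    congr 2
    ring
  have hE : ∀ i, ∫ x, f i (R • x) ∂stdGaussian (E i) = τ ^ (Module.finrank ℝ (E i) : ℝ) *
      ∫ x, Real.exp (-‖R⁻¹ • x‖ ^ 2 / 2) * f i x := fun i => by
    rw [integral_stdGaussian, ← hτn, mul_assoc]
    have := Measure.integral_comp_smul_of_nonneg (volume : Measure (E i))
      (fun x => Real.exp (-‖R⁻¹ • x‖ ^ 2 / 2) * f i x) R (hR := hR.le)
    rw [← smul_eq_mul (_⁻¹), ← this, ← integral_const_mul]
    simp only [gaussDensity, smul_eq_mul, inv_smul_smul₀ hR.ne', mul_assoc]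
  have hF : ∀ j, (2 * Real.pi) ^ (-(Module.finrank ℝ (F j) : ℝ) / 2) * ∫ y, g j (R • y) =
      τ ^ (Module.finrank ℝ (F j) : ℝ) * ∫ y, g j y := fun j => by
    rw [Measure.integral_comp_smul_of_nonneg (volume : Measure (F j)) (g j) R (hR := hR.le),
      smul_eq_mul, ← mul_assoc, hτn]
  simp only [hE, hF] at h
  have hE0 : ∀ i, 0 ≤ ∫ x, Real.exp (-‖R⁻¹ • x‖ ^ 2 / 2) * f i x := fun i =>
    integral_nonneg fun x => mul_nonneg (Real.exp_nonneg _) (hf0 i x)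
  have hF0 : ∀ j, 0 ≤ ∫ y, g j y := fun j => integral_nonneg (hg0 j)
  simp only [Real.mul_rpow (Real.rpow_nonneg hτ0.le _) (hE0 _),
    Real.mul_rpow (Real.rpow_nonneg hτ0.le _) (hF0 _), ← Real.rpow_mul hτ0.le,
    Finset.prod_mul_distrib, ← Real.rpow_sum_of_pos hτ0] at h
  have hsc : ∑ i, (Module.finrank ℝ (E i) : ℝ) * c i = ∑ j, (Module.finrank ℝ (F j) : ℝ) * d j := by
    simpa only [ScalingCond, mul_comm] using hscal
  rw [hsc] at h
  exact le_of_mul_le_mul_left h (Real.rpow_pos_of_pos hτ0 _)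

end CompactSupport

section Approximation

lemma tendsto_finsetProd_of_ne_zero {α ι : Type*} {l : Filter α} {s : Finset ι}
    {a : ι → α → ℝ≥0∞} {L : ι → ℝ≥0∞} (h : ∀ i ∈ s, Filter.Tendsto (a i) l (nhds (L i)))
    (hL : ∀ i ∈ s, L i ≠ 0) :
    Filter.Tendsto (fun x => ∏ i ∈ s, a i x) l (nhds (∏ i ∈ s, L i)) := by
  classical
  induction s using Finset.induction_on with
  | empty => simpa using tendsto_const_nhds
  | insert i s hi ih =>
    simp only [Finset.prod_insert hi]
    have hs : ∏ i ∈ s, L i ≠ 0 :=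
      Finset.prod_ne_zero_iff.2 fun j hj => hL j (Finset.mem_insert_of_mem hj)
    exact ENNReal.Tendsto.mul (h i (Finset.mem_insert_self i s)) (.inl (hL i (by simp)))
      (ih (fun j hj => h j (Finset.mem_insert_of_mem hj))
        fun j hj => hL j (Finset.mem_insert_of_mem hj)) (.inl hs)

variable {G : Type*} [NormedAddCommGroup G]

/-- Truncation of `f` at height `n`, restricted to the ball of radius `n`. -/
def ballTrunc (f : G → ℝ≥0) (n : ℕ) (x : G) : ℝ≥0 := if ‖x‖ ≤ n then min (f x) n else 0

lemma ballTrunc_le (f : G → ℝ≥0) (n : ℕ) (x : G) : ballTrunc f n x ≤ f x := by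
  unfold ballTrunc
  split_ifs
  · exact min_le_left _ _
  · exact zero_le

lemma ballTrunc_le_natCast (f : G → ℝ≥0) (n : ℕ) (x : G) : ballTrunc f n x ≤ n := by
  unfold ballTrunc
  split_ifs
  · exact min_le_right _ _
  · exact zero_le

lemma monotone_ballTrunc (f : G → ℝ≥0) (x : G) : Monotone fun n => ballTrunc f n x := by
  intro n p hnp
  have h : (n : ℝ) ≤ p := by exact_mod_cast hnp
  have h' : (n : ℝ≥0) ≤ p := by exact_mod_cast hnp
  simp only [ballTrunc]
  split_ifs with h1 h2
  · exact min_le_min_left _ h'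
  · exact absurd (h1.trans h) h2
  · exact zero_le
  · exact zero_le

lemma eventually_ballTrunc_eq (f : G → ℝ≥0) (x : G) :
    ∀ᶠ n in Filter.atTop, ballTrunc f n x = f x := by
  filter_upwards [tendsto_natCast_atTop_atTop.eventually_ge_atTop ‖x‖,
    tendsto_natCast_atTop_atTop.eventually_ge_atTop (f x)] with n h1 h2
  rw [ballTrunc, if_pos h1, min_eq_left h2]

lemma measurable_ballTrunc [MeasurableSpace G] [BorelSpace G] {f : G → ℝ≥0}
    (hf : Measurable f) (n : ℕ) : Measurable (ballTrunc f n) :=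
  Measurable.ite (measurableSet_le measurable_norm measurable_const)
    (hf.min measurable_const) measurable_const

lemma hasCompactSupport_ballTrunc [ProperSpace G] (f : G → ℝ≥0) (n : ℕ) :
    HasCompactSupport fun x => (ballTrunc f n x : ℝ) :=
  HasCompactSupport.intro (isCompact_closedBall 0 (n : ℝ)) fun x hx => by
    rw [mem_closedBall_zero_iff] at hx
    simp [ballTrunc, hx]

lemma tendsto_lintegral_exp_mul_ballTrunc [NormedSpace ℝ G] [MeasurableSpace G] [BorelSpace G]
    {f : G → ℝ≥0} (hf : Measurable f) (μ : Measure G) :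
    Filter.Tendsto (fun n : ℕ => ∫⁻ x, ENNReal.ofReal
        (Real.exp (-‖((n : ℝ) + 1)⁻¹ • x‖ ^ 2 / 2) * ballTrunc f n x) ∂μ)
      Filter.atTop (nhds (∫⁻ x, f x ∂μ)) := by
  refine lintegral_tendsto_of_tendsto_of_monotone (fun n => ?_) (ae_of_all _ fun x => ?_)
    (ae_of_all _ fun x => ?_)
  · have := (measurable_ballTrunc hf n).coe_nnreal_real
    have h2 : Measurable fun x : G => Real.exp (-‖((n : ℝ) + 1)⁻¹ • x‖ ^ 2 / 2) :=
      Continuous.measurable (by fun_prop)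
    exact (h2.mul this).ennreal_ofReal.aemeasurable
  · intro n p hnp
    refine ENNReal.ofReal_le_ofReal (mul_le_mul (Real.exp_le_exp.2 ?_)
      (NNReal.coe_le_coe.2 (monotone_ballTrunc f x hnp)) (NNReal.coe_nonneg _)
      (Real.exp_nonneg _))
    have h : ‖((p : ℝ) + 1)⁻¹ • x‖ ≤ ‖((n : ℝ) + 1)⁻¹ • x‖ := by
      rw [norm_smul, norm_smul, Real.norm_of_nonneg (by positivity),
        Real.norm_of_nonneg (by positivity)]
      gcongr
    have := pow_le_pow_left₀ (norm_nonneg _) h 2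
    linarith
  · have h1 : Filter.Tendsto (fun n : ℕ => ((n : ℝ) + 1)⁻¹ • x) Filter.atTop (nhds ((0 : ℝ) • x)) :=
      Filter.Tendsto.smul_const (by simpa using tendsto_one_div_add_atTop_nhds_zero_nat (𝕜 := ℝ)) x
    have h2 : Filter.Tendsto (fun n => (ballTrunc f n x : ℝ)) Filter.atTop (nhds (f x)) :=
      tendsto_const_nhds.congr' <| (eventually_ballTrunc_eq f x).mono fun n hn =>
        congrArg _ hn.symm
    have h3 := ENNReal.tendsto_ofReal
      ((Real.continuous_exp.tendsto _ |>.comp ((h1.norm.pow 2).neg.div_const 2)).mul h2)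
    simpa using h3

end Approximation

section Final

variable {k m : ℕ} {E : Fin k → Type*} {F : Fin m → Type*}
  [∀ i, NormedAddCommGroup (E i)] [∀ i, InnerProductSpace ℝ (E i)]
  [∀ i, FiniteDimensional ℝ (E i)]
  [∀ i, MeasurableSpace (E i)] [∀ i, BorelSpace (E i)]
  [∀ j, NormedAddCommGroup (F j)] [∀ j, InnerProductSpace ℝ (F j)]
  [∀ j, FiniteDimensional ℝ (F j)]
  [∀ j, MeasurableSpace (F j)] [∀ j, BorelSpace (F j)]
  {c : Fin k → ℝ} {d : Fin m → ℝ} {Q : ∀ j, PiLp 2 E →ₗ[ℝ] F j}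

lemma exists_lintegral_eq_zero (hc : ∀ i, 0 < c i) (hd : ∀ j, 0 < d j)
    {f : ∀ i, E i → ℝ≥0} {g : ∀ j, F j → ℝ≥0}
    (hf : ∀ i, Measurable (f i)) (hg : ∀ j, Measurable (g j))
    (hyp : ∀ x : PiLp 2 E, ∏ i, f i (x i) ^ c i ≤ ∏ j, g j (Q j x) ^ d j) {j : Fin m}
    (hQ : Function.Surjective (Q j)) (hj : ∫⁻ y, (g j y : ℝ≥0∞) = 0) :
    ∃ i, ∫⁻ x, (f i x : ℝ≥0∞) = 0 := by
  rw [lintegral_eq_zero_iff (hg j).coe_nnreal_ennreal] at hj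
  have hs : MeasurableSet (g j ⁻¹' {0}) := hg j (measurableSet_singleton 0)
  have h1 : ∀ᵐ y : F j, y ∈ g j ⁻¹' {0} := hj.mono fun y hy => by simpa using hy
  have h2 := (ae_comp_linearMap_mem_iff ((Q j) ∘ₗ (toPi E).symm.toLinearMap)
    (volume : Measure (∀ i, E i)) volume (hQ.comp (toPi E).symm.surjective) hs).2 h1
  have h3 : volume (Set.univ.pi fun i => {x | f i x ≠ 0}) = 0 := by
    refine measure_mono_null (fun z hz => ?_) (ae_iff.1 h2)
    intro h0
    have h4 := hyp ((toPi E).symm z)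
    rw [Finset.prod_eq_zero (f := fun j => g j _ ^ d j) (Finset.mem_univ j)
      (by rw [show g j (Q j ((toPi E).symm z)) = 0 from h0, NNReal.zero_rpow (hd j).ne']),
      nonpos_iff_eq_zero, Finset.prod_eq_zero_iff] at h4
    obtain ⟨i, -, hi⟩ := h4
    exact hz i trivial ((NNReal.rpow_eq_zero (hc i).ne').1 hi)
  rw [volume_pi_pi, Finset.prod_eq_zero_iff] at h3
  obtain ⟨i, -, hi⟩ := h3
  refine ⟨i, ?_⟩
  rw [lintegral_eq_zero_iff (hf i).coe_nnreal_ennreal, Filter.EventuallyEq, ae_iff]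
  simpa using hi

/-- The inequality when all the integrals on the right-hand side are finite. -/
lemma prod_lintegral_le_of_ne_top (hc : ∀ i, 0 < c i) (hd : ∀ j, 0 < d j)
    (hscal : ScalingCond E F c d) {S : PiLp 2 E →ₗ[ℝ] PiLp 2 E}
    (hS : S ∈ Coupling E (fun i => (LinearMap.id : E i →ₗ[ℝ] E i)))
    (hQS : ∀ j, ((Q j) ∘ₗ S) ∘ₗ LinearMap.adjoint (Q j) = LinearMap.id)
    (hQ : ∀ x : PiLp 2 E, (∑ j, d j * ⟪Q j x, Q j x⟫) ≤ ⟪Lam E c x, x⟫)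
    {f : ∀ i, E i → ℝ≥0} {g : ∀ j, F j → ℝ≥0}
    (hf : ∀ i, Measurable (f i)) (hg : ∀ j, Measurable (g j))
    (hyp : ∀ x : PiLp 2 E, ∏ i, f i (x i) ^ c i ≤ ∏ j, g j (Q j x) ^ d j)
    (hgt : ∀ j, ∫⁻ y, (g j y : ℝ≥0∞) ≠ ∞) :
    ∏ i, (∫⁻ x, (f i x : ℝ≥0∞)) ^ c i ≤ ∏ j, (∫⁻ y, (g j y : ℝ≥0∞)) ^ d j := by
  by_cases hz : ∃ i, ∫⁻ x, (f i x : ℝ≥0∞) = 0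
  · obtain ⟨i, hi⟩ := hz
    rw [Finset.prod_eq_zero (Finset.mem_univ i) (by rw [hi, ENNReal.zero_rpow_of_pos (hc i)])]
    exact zero_le
  push Not at hz
  have hgi : ∀ j, Integrable fun y => (g j y : ℝ) := fun j =>
    ⟨(hg j).coe_nnreal_real.aestronglyMeasurable, by
      simpa [HasFiniteIntegral, enorm_eq_nnnorm] using (hgt j).lt_top⟩
  have key : ∀ n : ℕ, ∏ i, (∫⁻ x, ENNReal.ofReal
      (Real.exp (-‖((n : ℝ) + 1)⁻¹ • x‖ ^ 2 / 2) * ballTrunc (f i) n x)) ^ c i ≤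
        ∏ j, (∫⁻ y, (g j y : ℝ≥0∞)) ^ d j := fun n => by
    have hbd : ∀ i x, (ballTrunc (f i) n x : ℝ) ≤ n := fun i x => by
      exact_mod_cast ballTrunc_le_natCast (f i) n x
    have hm : ∀ i, Measurable fun x => (ballTrunc (f i) n x : ℝ) := fun i =>
      (measurable_ballTrunc (hf i) n).coe_nnreal_real
    have h := prod_integral_exp_mul_le hc hd hscal hS hQS hQ n.cast_nonneg
      (f := fun i x => (ballTrunc (f i) n x : ℝ)) (g := fun j y => (g j y : ℝ)) hm
      (fun i x => NNReal.coe_nonneg _)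
      (fun i x => (hbd i x).trans ((le_add_of_nonneg_right zero_le_one).trans
        (Real.add_one_le_exp _)))
      (fun i => hasCompactSupport_ballTrunc (f i) n)
      (fun j => (hg j).coe_nnreal_real) (fun j y => NNReal.coe_nonneg _) hgi
      (fun x => by
        have := (Finset.prod_le_prod' fun i _ =>
          NNReal.rpow_le_rpow (ballTrunc_le (f i) n (x i)) (hc i).le).trans (hyp x)
        exact_mod_cast this)
      (R := (n : ℝ) + 1) (by positivity)
    have hi : ∀ i, Integrable fun x =>
        Real.exp (-‖((n : ℝ) + 1)⁻¹ • x‖ ^ 2 / 2) * (ballTrunc (f i) n x : ℝ) := fun i => by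
      have hb : Integrable fun x => (ballTrunc (f i) n x : ℝ) := by
        refine (integrableOn_iff_integrable_of_support_subset (subset_tsupport _)).1
          (Measure.integrableOn_of_bounded (M := n)
            (hasCompactSupport_ballTrunc (f i) n).isCompact.measure_lt_top.ne
            (hm i).aestronglyMeasurable (ae_of_all _ fun x => ?_))
        rw [Real.norm_of_nonneg (NNReal.coe_nonneg _)]
        exact hbd i x
      refine hb.mono' ((Continuous.measurable (by fun_prop)).mul (hm i)).aestronglyMeasurable
        (ae_of_all _ fun x => ?_)
      rw [Real.norm_of_nonneg (by positivity)]
      exact mul_le_of_le_one_left (NNReal.coe_nonneg _) (Real.exp_le_one_iff.2 (by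
        have := sq_nonneg ‖((n : ℝ) + 1)⁻¹ • x‖
        linarith))
    have h' := ENNReal.ofReal_le_ofReal h
    have hF0 : ∀ i, 0 ≤ ∫ x, Real.exp (-‖((n : ℝ) + 1)⁻¹ • x‖ ^ 2 / 2) *
        (ballTrunc (f i) n x : ℝ) := fun i => integral_nonneg fun x => by positivity
    have hG0 : ∀ j, 0 ≤ ∫ y, (g j y : ℝ) := fun j => integral_nonneg fun y => by positivity
    rw [ENNReal.ofReal_prod_of_nonneg fun i _ => Real.rpow_nonneg (hF0 i) _,
      ENNReal.ofReal_prod_of_nonneg fun j _ => Real.rpow_nonneg (hG0 j) _] at h'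
    simp only [← ENNReal.ofReal_rpow_of_nonneg (hF0 _) (hc _).le,
      ← ENNReal.ofReal_rpow_of_nonneg (hG0 _) (hd _).le] at h'
    simpa only [ofReal_integral_eq_lintegral_ofReal (hi _) (ae_of_all _ fun x =>
        mul_nonneg (Real.exp_nonneg _) (NNReal.coe_nonneg _)),
      ofReal_integral_eq_lintegral_ofReal (hgi _) (ae_of_all _ fun y => NNReal.coe_nonneg _),
      ENNReal.ofReal_coe_nnreal] using h'
  refine le_of_tendsto' (x := Filter.atTop) (tendsto_finsetProd_of_ne_zero (fun i _ =>
    (ENNReal.continuous_rpow_const.tendsto _).comp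
      (tendsto_lintegral_exp_mul_ballTrunc (hf i) volume)) fun i _ => ?_) key
  simp [ENNReal.rpow_eq_zero_iff, hz i, (hc i).le]

end Final

end FRBL

namespace FRBL

variable {k m : ℕ}
  (E : Fin k → Type*) (F : Fin m → Type*)
  [∀ i, NormedAddCommGroup (E i)] [∀ i, InnerProductSpace ℝ (E i)]
  [∀ i, FiniteDimensional ℝ (E i)]
  [∀ i, MeasurableSpace (E i)] [∀ i, BorelSpace (E i)]
  [∀ j, NormedAddCommGroup (F j)] [∀ j, InnerProductSpace ℝ (F j)]
  [∀ j, FiniteDimensional ℝ (F j)]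
  [∀ j, MeasurableSpace (F j)] [∀ j, BorelSpace (F j)]

/-- **Corollary (geometric forward-reverse Brascamp-Lieb inequality, first form).** -/
theorem geometric_FRBL_I
    (c : Fin k → ℝ) (d : Fin m → ℝ)
    (hc : ∀ i, 0 < c i) (hd : ∀ j, 0 < d j)
    (hscal : ScalingCond E F c d)
    (Q : ∀ j, PiLp 2 E →ₗ[ℝ] F j)
    (S : PiLp 2 E →ₗ[ℝ] PiLp 2 E)
    (hS : S ∈ Coupling E (fun i => (LinearMap.id : E i →ₗ[ℝ] E i)))
    (hQS : ∀ j, ((Q j) ∘ₗ S) ∘ₗ LinearMap.adjoint (Q j) = LinearMap.id)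
    (hQ : ∀ x : PiLp 2 E, (∑ j, d j * ⟪Q j x, Q j x⟫) ≤ ⟪Lam E c x, x⟫)
    (f : ∀ i, E i → ℝ≥0) (g : ∀ j, F j → ℝ≥0)
    (hf : ∀ i, Measurable (f i)) (hg : ∀ j, Measurable (g j))
    (hyp : ∀ x : PiLp 2 E,
      (∏ i, f i (projL E i x) ^ c i) ≤ ∏ j, g j (Q j x) ^ d j) :
    (∏ i, (∫⁻ x, (f i x : ℝ≥0∞)) ^ c i) ≤ ∏ j, (∫⁻ y, (g j y : ℝ≥0∞)) ^ d j := by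
  have hyp' : ∀ x : PiLp 2 E, ∏ i, f i (x i) ^ c i ≤ ∏ j, g j (Q j x) ^ d j := hyp
  by_cases h0 : ∃ j, ∫⁻ y, (g j y : ℝ≥0∞) = 0
  · obtain ⟨j, hj⟩ := h0
    have hsurj : Function.Surjective (Q j) := fun y =>
      ⟨S (LinearMap.adjoint (Q j) y), LinearMap.congr_fun (hQS j) y⟩
    obtain ⟨i, hi⟩ := exists_lintegral_eq_zero hc hd hf hg hyp' hsurj hj
    rw [Finset.prod_eq_zero (Finset.mem_univ i) (by rw [hi, ENNReal.zero_rpow_of_pos (hc i)])]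
    exact zero_le
  by_cases ht : ∃ j, ∫⁻ y, (g j y : ℝ≥0∞) = ∞
  · obtain ⟨j, hj⟩ := ht
    push Not at h0
    rw [← Finset.mul_prod_erase _ _ (Finset.mem_univ j), hj, ENNReal.top_rpow_of_pos (hd j),
      ENNReal.top_mul]
    · exact le_top
    · exact Finset.prod_ne_zero_iff.2 fun j _ => by
        simp [ENNReal.rpow_eq_zero_iff, h0 j, (hd j).le]
  push Not at ht
  exact prod_lintegral_le_of_ne_top hc hd hscal hS hQS hQ hf hg hyp' ht

end FRBL
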